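/- Assume the Generalized Riemann Hypothesis for all Dirichlet L-functions. Let ε and α be real numbers with 0 < ε < α, and for each pair of odd coprime positive integers m, n let a(m, n) be an integer with a(m, n) ≡ −2 (mod m²) and a(m, n) ≡ 2 (mod n²). Then the sum Σ |θ(x; m²n², a(m, n)) − x/φ(m²n²)|, taken over all pairs of odd coprime positive integers m, n with x^ε < m < x^α and x^ε < n < x^α, is O(x^{1/2 + 2α}·(log x)²) as x → ∞. -/

import Mathlib

open scoped Classical

/-- The Generalized Riemann Hypothesis for all Dirichlet L-functions: for every positive
modulus `q`, every Dirichlet character `χ` mod `q` and every `s` in the critical strip,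
if `L(s, χ) = 0` then `Re s = 1/2`. -/
def GRH : Prop :=
  ∀ (q : ℕ) [NeZero q] (χ : DirichletCharacter ℂ q) (s : ℂ),
    0 < s.re → s.re < 1 → DirichletCharacter.LFunction χ s = 0 → s.re = 1 / 2

/-- The Chebyshev function `θ(x; q, a) = ∑_{p < x, p ≡ a [q]} log p`. -/
noncomputable def theta (x : ℝ) (q : ℕ) (a : ℤ) : ℝ :=
  ∑ p ∈ (Finset.range ⌈x⌉₊).filter
      (fun p : ℕ => p.Prime ∧ (p : ZMod q) = (a : ZMod q)), Real.log p

section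
open Complex Metric ComplexConjugate

/-- Division by a Blaschke factor. -/
lemma exists_div_blaschke_factor {F : ℂ → ℂ} {U : Set ℂ} {R r B : ℝ} {ρ : ℂ}
    (hU : IsOpen U) (hr : 0 < r) (hrR : r < R) (hRU : closedBall 0 R ⊆ U)
    (hF : DifferentiableOn ℂ F U) (hB : ∀ z ∈ closedBall (0 : ℂ) R, ‖F z‖ ≤ B)
    (hρ : ρ ∈ closedBall (0 : ℂ) r) (hρ0 : F ρ = 0) (hF0 : F 0 ≠ 0) :
    ∃ G : ℂ → ℂ, DifferentiableOn ℂ G U ∧ (∀ z ∈ closedBall (0 : ℂ) R, ‖G z‖ ≤ B) ∧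
      ‖F 0‖ * (R / r) ≤ ‖G 0‖ ∧
      (∀ z ∈ closedBall (0 : ℂ) r, F z ≠ 0 → G z ≠ 0 ∧
        logDeriv F z = logDeriv G z + (1 / (z - ρ) + conj ρ / (R ^ 2 - conj ρ * z))) := by
  have hR : 0 < R := hr.trans hrR
  have hρr : ‖ρ‖ ≤ r := by simpa using hρ
  have hρne : ρ ≠ 0 := fun h => hF0 (h ▸ hρ0)
  have hρU : ρ ∈ U := hRU (closedBall_subset_closedBall hrR.le hρ)
  have hden : ∀ z : ℂ, ‖z‖ ≤ R → (R : ℂ) ^ 2 - conj ρ * z ≠ 0 := by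
    intro z hz h
    have h1 : ‖(R : ℂ) ^ 2‖ = ‖conj ρ * z‖ := by rw [sub_eq_zero.mp h]
    rw [norm_mul, RCLike.norm_conj, norm_pow, Complex.norm_real, Real.norm_of_nonneg hR.le] at h1
    nlinarith [norm_nonneg z, norm_nonneg ρ]
  set D := dslope F ρ with hD
  have hDd : DifferentiableOn ℂ D U := (differentiableOn_dslope (hU.mem_nhds hρU)).mpr hF
  have hFD : ∀ z, F z = (z - ρ) * D z := by
    intro z
    have := sub_smul_dslope F ρ z
    rw [hρ0, sub_zero, smul_eq_mul] at this
    exact this.symm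
  have hlin : ∀ z : ℂ, HasDerivAt (fun z : ℂ => ((R : ℂ) ^ 2 - conj ρ * z) / R)
      (-conj ρ / R) z := by
    intro z
    have := (((hasDerivAt_id z).const_mul (conj ρ)).const_sub ((R : ℂ) ^ 2)).div_const (R : ℂ)
    simpa using this
  set G : ℂ → ℂ := fun z => D z * (((R : ℂ) ^ 2 - conj ρ * z) / R) with hG
  have hGd : DifferentiableOn ℂ G U :=
    hDd.mul fun z _ => (hlin z).differentiableAt.differentiableWithinAt
  have hRC : (R : ℂ) ≠ 0 := by exact_mod_cast hR.ne'
  refine ⟨G, hGd, ?_, ?_, ?_⟩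
  · intro z hz
    have hcl : closure (ball (0 : ℂ) R) = closedBall 0 R := closure_ball _ hR.ne'
    refine Complex.norm_le_of_forall_mem_frontier_norm_le isBounded_ball
      (hGd.diffContOnCl_ball hRU) (fun w hw => ?_) (by rwa [hcl])
    rw [frontier_ball _ hR.ne'] at hw
    have hw' : ‖w‖ = R := by simpa using hw
    have hwB := hB w (sphere_subset_closedBall hw)
    have hne : w - ρ ≠ 0 := by
      intro h
      have : ‖w‖ = ‖ρ‖ := by rw [sub_eq_zero.mp h]
      linarith
    have key : ‖(R : ℂ) ^ 2 - conj ρ * w‖ = R * ‖w - ρ‖ := by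
      have h1 : (R : ℂ) ^ 2 = conj w * w := by
        rw [← Complex.normSq_eq_conj_mul_self, Complex.normSq_eq_norm_sq, hw']; push_cast; ring
      rw [h1, ← sub_mul, norm_mul, ← map_sub, RCLike.norm_conj, hw', mul_comm]
    have : ‖G w‖ = ‖F w‖ := by
      rw [hFD w, hG]
      simp only [norm_mul, norm_div, key, Complex.norm_real, Real.norm_of_nonneg hR.le]
      field_simp
    rw [this]; exact hwB
  · have h0 : ‖G 0‖ = ‖D 0‖ * R := by
      simp only [hG, norm_mul, mul_zero, sub_zero, norm_div, norm_pow, Complex.norm_real,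
        Real.norm_of_nonneg hR.le]
      field_simp
    have h1 : ‖F 0‖ = ‖ρ‖ * ‖D 0‖ := by rw [hFD 0]; simp
    rw [h0, h1]
    have : ‖ρ‖ * ‖D 0‖ * (R / r) = (‖ρ‖ / r) * (‖D 0‖ * R) := by ring
    rw [this]
    exact mul_le_of_le_one_left (by positivity) ((div_le_one hr).mpr hρr)
  · intro z hz hFz
    have hzr : ‖z‖ ≤ r := by simpa using hz
    have hzU : z ∈ U := hRU (closedBall_subset_closedBall hrR.le hz)
    have hd0 := hden z (hzr.trans hrR.le)
    rw [hFD z] at hFz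
    have hzρ : z - ρ ≠ 0 := left_ne_zero_of_mul hFz
    have hDz : D z ≠ 0 := right_ne_zero_of_mul hFz
    have hDat : DifferentiableAt ℂ D z := hDd.differentiableAt (hU.mem_nhds hzU)
    have hlz : ((R : ℂ) ^ 2 - conj ρ * z) / R ≠ 0 := div_ne_zero hd0 hRC
    refine ⟨mul_ne_zero hDz hlz, ?_⟩
    have hFeq : F = fun z => (z - ρ) * D z := funext hFD
    have hs : HasDerivAt (fun z : ℂ => z - ρ) 1 z := (hasDerivAt_id z).sub_const ρ
    have e1 : logDeriv F z = 1 / (z - ρ) + logDeriv D z := by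
      rw [hFeq, logDeriv_mul (f := fun z => z - ρ) z hzρ hDz hs.differentiableAt hDat]
      rw [logDeriv_apply (fun z => z - ρ), hs.deriv]
    have e2 : logDeriv G z = logDeriv D z + (-conj ρ) / ((R : ℂ) ^ 2 - conj ρ * z) := by
      rw [hG, logDeriv_mul (g := fun z => ((R : ℂ) ^ 2 - conj ρ * z) / R) z hDz hlz hDat
        (hlin z).differentiableAt]
      rw [logDeriv_apply (fun z => ((R : ℂ) ^ 2 - conj ρ * z) / R), (hlin z).deriv]
      field_simp
    rw [e1, e2]
    ring

/-- Removing all zeros in a closed disc by Blaschke factors. -/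
lemma exists_blaschke_decomposition {U : Set ℂ} {R r : ℝ}
    (hU : IsOpen U) (hr : 0 < r) (hrR : r < R) (hRU : closedBall 0 R ⊆ U) (n : ℕ) :
    ∀ (F : ℂ → ℂ) (B : ℝ), DifferentiableOn ℂ F U → (∀ z ∈ closedBall (0 : ℂ) R, ‖F z‖ ≤ B) →
    F 0 ≠ 0 → B < ‖F 0‖ * (R / r) ^ n →
    ∃ (Z : Multiset ℂ) (G : ℂ → ℂ), DifferentiableOn ℂ G U ∧
      (∀ z ∈ closedBall (0 : ℂ) R, ‖G z‖ ≤ B) ∧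
      ‖F 0‖ * (R / r) ^ (Multiset.card Z) ≤ ‖G 0‖ ∧
      (∀ ρ ∈ Z, F ρ = 0 ∧ ρ ∈ closedBall (0 : ℂ) r) ∧
      (∀ z ∈ closedBall (0 : ℂ) r, G z ≠ 0) ∧
      (∀ z ∈ closedBall (0 : ℂ) r, F z ≠ 0 →
        logDeriv F z = logDeriv G z +
          (Z.map fun ρ => 1 / (z - ρ) + conj ρ / (R ^ 2 - conj ρ * z)).sum) := by
  have hR : 0 < R := hr.trans hrR
  induction n with
  | zero =>
    intro F B hF hB hF0 hlt
    have := hB 0 (by simp [hR.le])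
    simp at hlt
    linarith
  | succ n ih =>
    intro F B hF hB hF0 hlt
    by_cases hz : ∃ ρ ∈ closedBall (0 : ℂ) r, F ρ = 0
    · obtain ⟨ρ, hρ, hρ0⟩ := hz
      obtain ⟨G, hGd, hGB, hG0, hGl⟩ :=
        exists_div_blaschke_factor hU hr hrR hRU hF hB hρ hρ0 hF0
      have hG0' : G 0 ≠ 0 := (hGl 0 (by simp [hr.le]) hF0).1
      have hpos : 0 < (R / r) ^ n := by positivity
      obtain ⟨Z, G', h1, h2, h3, h4, h5, h6⟩ := ih G B hGd hGB hG0' (by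
        refine hlt.trans_le ?_
        rw [pow_succ', ← mul_assoc]
        gcongr)
      refine ⟨ρ ::ₘ Z, G', h1, h2, ?_, ?_, h5, ?_⟩
      · refine le_trans ?_ h3
        rw [Multiset.card_cons, pow_succ', ← mul_assoc]
        gcongr
      · intro ρ' hρ'
        rcases Multiset.mem_cons.mp hρ' with rfl | h
        · exact ⟨hρ0, hρ⟩
        · refine ⟨?_, (h4 ρ' h).2⟩
          by_contra hne
          exact (hGl ρ' (h4 ρ' h).2 hne).1 (h4 ρ' h).1
      · intro z hz hFz
        rw [(hGl z hz hFz).2, h6 z hz (hGl z hz hFz).1, Multiset.map_cons, Multiset.sum_cons]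
        ring
    · push Not at hz
      exact ⟨0, F, hF, hB, by simp, by simp, hz, by simp⟩

/-- The logarithmic derivative of a bounded zero-free function on a disc. -/
lemma norm_logDeriv_le_of_ne_zero {G : ℂ → ℂ} {r r' M : ℝ} (hr' : 0 < r') (hrr : r' < r)
    (hM : 0 < M) (hG : DifferentiableOn ℂ G (ball 0 r)) (hG0 : ∀ z ∈ ball (0 : ℂ) r, G z ≠ 0)
    (hGM : ∀ z ∈ ball (0 : ℂ) r, ‖G z‖ ≤ Real.exp M * ‖G 0‖) {z : ℂ}
    (hz : z ∈ closedBall (0 : ℂ) r') :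
    ‖logDeriv G z‖ ≤ 8 * r / (r - r') ^ 2 * M := by
  have hr : 0 < r := hr'.trans hrr
  have h0 : (0 : ℂ) ∈ ball (0 : ℂ) r := by simp [hr]
  have hdl : DifferentiableOn ℂ (fun z => deriv G z / G z) (ball 0 r) :=
    (hG.deriv isOpen_ball).div hG hG0
  obtain ⟨h₁, hh₁⟩ := hdl.isExactOn_ball
  set h : ℂ → ℂ := fun z => h₁ z - h₁ 0 with hh
  have hhd : ∀ z ∈ ball (0 : ℂ) r, HasDerivAt h (deriv G z / G z) z := fun z hz =>
    (hh₁ z hz).sub_const _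
  have hhdiff : DifferentiableOn ℂ h (ball 0 r) := fun z hz =>
    (hhd z hz).differentiableAt.differentiableWithinAt
  have hconst : ∀ z ∈ ball (0 : ℂ) r, G z * exp (-h z) = G 0 := by
    intro z hz
    have hd : ∀ w ∈ ball (0 : ℂ) r, HasDerivAt (fun w => G w * exp (-h w)) 0 w := by
      intro w hw
      have h1 := (hG.differentiableAt (isOpen_ball.mem_nhds hw)).hasDerivAt
      have h2 := ((hhd w hw).neg).cexp
      have h3 := h1.mul h2
      refine h3.congr_deriv ?_
      have hGw : G w * (deriv G w / G w) = deriv G w := mul_div_cancel₀ _ (hG0 w hw)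
      linear_combination (-cexp (-h w)) * hGw
    have := isOpen_ball.is_const_of_deriv_eq_zero (convex_ball (0 : ℂ) r).isPreconnected
      (fun w hw => (hd w hw).differentiableAt.differentiableWithinAt)
      (fun w hw => (hd w hw).deriv) hz h0
    simpa [hh] using this
  have hre : Set.MapsTo h (ball 0 r) {z | z.re ≤ M} := by
    intro z hz
    have h1 := hconst z hz
    have h2 : ‖G z‖ = ‖G 0‖ * Real.exp (h z).re := by
      rw [← h1, norm_mul, Complex.norm_exp, mul_assoc, ← Real.exp_add]
      simp
    have h3 := hGM z hz
    rw [h2, mul_comm] at h3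
    have h4 : 0 < ‖G 0‖ := norm_pos_iff.mpr (hG0 0 h0)
    exact Real.exp_le_exp.mp (le_of_mul_le_mul_right h3 h4)
  have hbc : ∀ w, ‖w‖ ≤ (r + r') / 2 → ‖h w‖ ≤ 4 * r / (r - r') * M := by
    intro w hw
    have hwr : ‖w‖ < r := by linarith
    have := borelCaratheodory_zero hM hhdiff hre hr (by simpa using hwr) (by simp [hh])
    refine this.trans ?_
    rw [div_mul_eq_mul_div, div_le_div_iff₀ (by linarith) (by linarith)]
    have h5 : (r - r') / 2 ≤ r - ‖w‖ := by linarith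
    have h6 : M * ‖w‖ ≤ M * r := by gcongr
    nlinarith [mul_nonneg hM.le (norm_nonneg w), mul_nonneg hM.le hr.le,
      mul_le_mul_of_nonneg_right h6 (by linarith : 0 ≤ r - r'),
      mul_le_mul_of_nonneg_left h5 (mul_nonneg hM.le hr.le)]
  have hzr : ‖z‖ ≤ r' := by simpa using hz
  have hzb : z ∈ ball (0 : ℂ) r := by simp; linarith
  have hlog : logDeriv G z = deriv h z := by rw [(hhd z hzb).deriv, logDeriv_apply]
  have hsub : closedBall z ((r - r') / 2) ⊆ ball 0 r := by
    intro w hw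
    have : ‖w - z‖ ≤ (r - r') / 2 := by simpa [dist_eq_norm] using hw
    have h7 := norm_le_norm_add_norm_sub' w z
    simp
    linarith
  rw [hlog]
  have := norm_deriv_le_of_forall_mem_sphere_norm_le (c := z) (R := (r - r') / 2) (f := h)
    (C := 4 * r / (r - r') * M) (by linarith)
    (hhdiff.diffContOnCl_ball hsub) (fun w hw => by
      apply hbc
      have : ‖w - z‖ = (r - r') / 2 := by simpa [dist_eq_norm] using hw
      have h7 := norm_le_norm_add_norm_sub' w z
      linarith)
  refine this.trans (le_of_eq ?_)
  have : r - r' ≠ 0 := by linarith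
  field_simp
  ring

/-- Local partial fraction expansion of the logarithmic derivative. -/
theorem exists_logDeriv_partial_fraction {r' r R : ℝ} (hr' : 0 < r') (hrr : r' < r) (hrR : r < R) :
    ∃ C : ℝ, 0 < C ∧ ∀ (F : ℂ → ℂ) (U : Set ℂ) (c : ℂ) (M : ℝ), IsOpen U → closedBall c R ⊆ U →
      DifferentiableOn ℂ F U → 0 < M → F c ≠ 0 →
      (∀ z ∈ closedBall c R, ‖F z‖ ≤ Real.exp M * ‖F c‖) →
      ∃ Z : Multiset ℂ, (∀ ρ ∈ Z, F ρ = 0 ∧ ρ ∈ closedBall c r) ∧ (Multiset.card Z : ℝ) ≤ C * M ∧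
        ∀ z ∈ closedBall c r', F z ≠ 0 →
          ‖logDeriv F z - (Z.map fun ρ => 1 / (z - ρ)).sum‖ ≤ C * M := by
  have hr : 0 < r := hr'.trans hrr
  have hR : 0 < R := hr.trans hrR
  have hlog : 0 < Real.log (R / r) := Real.log_pos ((one_lt_div hr).mpr hrR)
  have hd : 0 < r - r' := by linarith
  have hd2 : 0 < R ^ 2 - r ^ 2 := by nlinarith
  set C₁ := 1 / Real.log (R / r) with hC₁
  set C₂ := 8 * r / (r - r') ^ 2 with hC₂
  set C₃ := r / (R ^ 2 - r ^ 2) with hC₃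
  have hC₁p : 0 < C₁ := by positivity
  have hC₂p : 0 < C₂ := by positivity
  have hC₃p : 0 < C₃ := by positivity
  refine ⟨C₁ + C₂ + C₁ * C₃, by positivity, ?_⟩
  intro F₀ U₀ c M hU₀ hRU₀ hF₀ hM hFc hFM₀
  -- translate to the origin
  set F : ℂ → ℂ := fun z => F₀ (c + z) with hFdef
  set U : Set ℂ := (fun z => c + z) ⁻¹' U₀ with hUdef
  have hU : IsOpen U := hU₀.preimage (by fun_prop)
  have htr : ∀ (z : ℂ) (t : ℝ), z ∈ closedBall (0 : ℂ) t → c + z ∈ closedBall c t := by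
    intro z t hz; simpa using hz
  have hRU : closedBall 0 R ⊆ U := fun z hz => hRU₀ (htr z R hz)
  have hF : DifferentiableOn ℂ F U :=
    hF₀.comp (by fun_prop) (fun z hz => hz)
  have hF0 : F 0 ≠ 0 := by simpa [hFdef] using hFc
  have hFM : ∀ z ∈ closedBall (0 : ℂ) R, ‖F z‖ ≤ Real.exp M * ‖F 0‖ := fun z hz => by
    simpa [hFdef] using hFM₀ _ (htr z R hz)
  have hFpos : 0 < ‖F 0‖ := norm_pos_iff.mpr hF0
  obtain ⟨n, hn⟩ := pow_unbounded_of_one_lt (Real.exp M) ((one_lt_div hr).mpr hrR)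
  obtain ⟨Z, G, h1, h2, h3, h4, h5, h6⟩ := exists_blaschke_decomposition hU hr hrR hRU n F
    (Real.exp M * ‖F 0‖) hF hFM hF0 (by rw [mul_comm]; gcongr)
  have hone : 1 ≤ (R / r) ^ (Multiset.card Z) := one_le_pow₀ ((one_lt_div hr).mpr hrR).le
  have hcard : (Multiset.card Z : ℝ) ≤ C₁ * M := by
    have h7 := h3.trans (h2 0 (by simp [hR.le]))
    rw [mul_comm] at h7
    have h8 := le_of_mul_le_mul_right h7 hFpos
    have h9 := Real.log_le_log (by positivity) h8
    rw [Real.log_exp, Real.log_pow] at h9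
    rw [hC₁, div_mul_eq_mul_div, one_mul, le_div_iff₀ hlog]
    exact h9
  refine ⟨Z.map (fun ρ => c + ρ), ?_, ?_, ?_⟩
  · intro ρ hρ
    obtain ⟨ρ', hρ', rfl⟩ := Multiset.mem_map.mp hρ
    exact ⟨(h4 ρ' hρ').1, htr _ _ (h4 ρ' hρ').2⟩
  · rw [Multiset.card_map]
    refine hcard.trans ?_
    nlinarith [mul_pos hC₂p hM, mul_pos (mul_pos hC₁p hC₃p) hM]
  · intro z₀ hz₀ hFz₀
    obtain ⟨z, rfl⟩ : ∃ z, z₀ = c + z := ⟨z₀ - c, by ring⟩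
    have hz : z ∈ closedBall (0 : ℂ) r' := by simpa using hz₀
    have hzr : z ∈ closedBall (0 : ℂ) r := closedBall_subset_closedBall hrr.le hz
    have hzn : ‖z‖ ≤ r := by simpa using hzr
    have hld : logDeriv F₀ (c + z) = logDeriv F z := by
      rw [logDeriv_apply, logDeriv_apply, hFdef, deriv_comp_const_add]
    have hsum : ((Z.map (fun ρ => c + ρ)).map fun ρ => 1 / (c + z - ρ)).sum
        = (Z.map fun ρ => 1 / (z - ρ)).sum := by
      rw [Multiset.map_map]
      congr 1
      apply Multiset.map_congr rfl
      intro ρ _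
      simp
    rw [hld, hsum, h6 z hzr hFz₀, Multiset.sum_map_add]
    have hG : ‖logDeriv G z‖ ≤ C₂ * M := by
      refine norm_logDeriv_le_of_ne_zero hr' hrr hM
        (h1.mono fun w hw => hRU (closedBall_subset_closedBall hrR.le (ball_subset_closedBall hw)))
        (fun w hw => h5 w (ball_subset_closedBall hw)) (fun w hw => ?_) hz
      refine (h2 w (closedBall_subset_closedBall hrR.le (ball_subset_closedBall hw))).trans ?_
      gcongr
      refine le_trans ?_ h3
      exact le_mul_of_one_le_right hFpos.le hone
    have hS : ‖(Z.map fun ρ => conj ρ / ((R : ℂ) ^ 2 - conj ρ * z)).sum‖ ≤ C₁ * C₃ * M := by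
      have hb : ∀ ρ ∈ Z, ‖conj ρ / ((R : ℂ) ^ 2 - conj ρ * z)‖ ≤ C₃ := by
        intro ρ hρ
        have hρn : ‖ρ‖ ≤ r := by simpa using (h4 ρ hρ).2
        rw [norm_div, RCLike.norm_conj, hC₃]
        have : R ^ 2 - r ^ 2 ≤ ‖(R : ℂ) ^ 2 - conj ρ * z‖ := by
          have h10 := norm_sub_norm_le ((R : ℂ) ^ 2) (conj ρ * z)
          rw [norm_mul, RCLike.norm_conj, norm_pow, Complex.norm_real,
            Real.norm_of_nonneg hR.le] at h10
          have : ‖ρ‖ * ‖z‖ ≤ r * r := by gcongr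
          nlinarith
        gcongr
      have h11 : ‖(Z.map fun ρ => conj ρ / ((R : ℂ) ^ 2 - conj ρ * z)).sum‖
          ≤ (Z.map fun ρ => ‖conj ρ / ((R : ℂ) ^ 2 - conj ρ * z)‖).sum := by
        have := norm_multiset_sum_le (Z.map fun ρ => conj ρ / ((R : ℂ) ^ 2 - conj ρ * z))
        rwa [Multiset.map_map] at this
      refine h11.trans ?_
      have h12 := Multiset.sum_le_card_nsmul
        (Z.map fun ρ => ‖conj ρ / ((R : ℂ) ^ 2 - conj ρ * z)‖) C₃ (by
          intro y hy
          obtain ⟨ρ, hρ, rfl⟩ := Multiset.mem_map.mp hy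
          exact hb ρ hρ)
      rw [Multiset.card_map, nsmul_eq_mul] at h12
      refine h12.trans ?_
      calc (Multiset.card Z : ℝ) * C₃ ≤ C₁ * M * C₃ := by gcongr
        _ = C₁ * C₃ * M := by ring
    calc _ = ‖logDeriv G z + (Z.map fun ρ => conj ρ / ((R : ℂ) ^ 2 - conj ρ * z)).sum‖ := by
          congr 1; ring
      _ ≤ C₂ * M + C₁ * C₃ * M := (norm_add_le _ _).trans (add_le_add hG hS)
      _ ≤ _ := by nlinarith [mul_pos hC₁p hM]

end

section
open Complex Metric MeasureTheory Set Filter Asymptotics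

/-- The mean value of a Dirichlet character. -/
noncomputable def charMean {q : ℕ} [NeZero q] (χ : DirichletCharacter ℂ q) : ℂ :=
  (∑ a : ZMod q, χ a) / q

lemma norm_charMean_le_one {q : ℕ} [NeZero q] (χ : DirichletCharacter ℂ q) : ‖charMean χ‖ ≤ 1 := by
  have hq : (0 : ℝ) < q := by exact_mod_cast NeZero.pos q
  rw [charMean, norm_div, Complex.norm_natCast, div_le_one hq]
  refine (norm_sum_le _ _).trans ?_
  refine (Finset.sum_le_sum fun a _ => χ.norm_le_one a).trans ?_
  simp [ZMod.card]

lemma charMean_eq_zero {q : ℕ} [NeZero q] {χ : DirichletCharacter ℂ q} (hχ : χ ≠ 1) :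
    charMean χ = 0 := by
  rw [charMean, χ.sum_eq_zero_of_ne_one hχ, zero_div]

lemma norm_sum_range_charMean_le {q : ℕ} [NeZero q] (χ : DirichletCharacter ℂ q) (n : ℕ) :
    ‖∑ k ∈ Finset.range n, (χ k - charMean χ)‖ ≤ 2 * q := by
  have hq : (q : ℂ) ≠ 0 := by exact_mod_cast NeZero.ne q
  have hterm : ∀ k : ℕ, ‖χ k - charMean χ‖ ≤ 2 := fun k =>
    (norm_sub_le _ _).trans (by linarith [χ.norm_le_one (k : ZMod q), norm_charMean_le_one χ])
  have hper : ∑ k ∈ Finset.range q, (χ k - charMean χ) = 0 := by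
    have h1 : ∑ k ∈ Finset.range q, χ (k : ZMod q) = ∑ a : ZMod q, χ a := by
      refine Finset.sum_bij' (fun k _ => (k : ZMod q)) (fun a _ => a.val) ?_ ?_ ?_ ?_ ?_
      · simp
      · intro a _; simpa using ZMod.val_lt a
      · intro k hk; exact ZMod.val_natCast_of_lt (Finset.mem_range.mp hk)
      · simp
      · simp
    rw [Finset.sum_sub_distrib, h1, charMean]
    simp [mul_div_cancel₀ _ hq]
  induction n using Nat.strong_induction_on with
  | _ n ih =>
    by_cases hn : n < q
    · refine (norm_sum_le _ _).trans ((Finset.sum_le_sum fun k _ => hterm k).trans ?_)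
      have : (n : ℝ) ≤ q := by exact_mod_cast hn.le
      simp
      linarith
    · obtain ⟨m, rfl⟩ := Nat.exists_eq_add_of_le (not_lt.mp hn)
      rw [Finset.sum_range_add, hper, zero_add]
      have := ih m (by have := NeZero.pos q; omega)
      simpa using this

/-- The error term in the count of a Dirichlet character up to `t`. -/
noncomputable def charRemainder {q : ℕ} [NeZero q] (χ : DirichletCharacter ℂ q) (t : ℝ) : ℂ :=
  ∑ k ∈ Finset.Icc 1 ⌊t⌋₊, χ k - charMean χ * t

lemma norm_charRemainder_le {q : ℕ} [NeZero q] (χ : DirichletCharacter ℂ q) {t : ℝ} (ht : 0 ≤ t) :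
    ‖charRemainder χ t‖ ≤ 5 * q := by
  have hq : (1 : ℝ) ≤ q := by exact_mod_cast NeZero.one_le
  have h1 := norm_sum_range_charMean_le χ (⌊t⌋₊ + 1)
  have h2 : charRemainder χ t = ∑ k ∈ Finset.range (⌊t⌋₊ + 1), (χ k - charMean χ)
      + (charMean χ * (⌊t⌋₊ + 1 - t : ℝ) - χ (0 : ℕ)) := by
    rw [charRemainder, Finset.sum_sub_distrib, Finset.range_eq_Ico,
      Finset.sum_eq_sum_Ico_succ_bot (Nat.succ_pos _)]
    simp only [Finset.sum_const, Nat.card_Ico, nsmul_eq_mul]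
    have : Finset.Ico (0 + 1) (⌊t⌋₊ + 1) = Finset.Icc 1 ⌊t⌋₊ := by ext; simp
    rw [this]
    push_cast
    ring
  rw [h2]
  have h3 : ‖charMean χ * (⌊t⌋₊ + 1 - t : ℝ)‖ ≤ 1 := by
    rw [norm_mul, Complex.norm_real]
    have h4 : |(⌊t⌋₊ + 1 - t : ℝ)| ≤ 1 := by
      rw [abs_le]; constructor <;> linarith [Nat.floor_le ht, Nat.lt_floor_add_one t]
    exact mul_le_one₀ (norm_charMean_le_one χ) (abs_nonneg _) h4
  calc _ ≤ 2 * (q : ℝ) + (1 + 1) := by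
        refine (norm_add_le _ _).trans (add_le_add h1 ((norm_sub_le _ _).trans
          (add_le_add h3 (χ.norm_le_one _))))
    _ ≤ 5 * q := by linarith

lemma measurable_charRemainder {q : ℕ} [NeZero q] (χ : DirichletCharacter ℂ q) :
    Measurable (charRemainder χ) := by
  unfold charRemainder
  refine Measurable.sub ?_ (by fun_prop)
  exact (measurable_from_nat (f := fun n : ℕ => ∑ k ∈ Finset.Icc 1 n, χ k)).comp Nat.measurable_floor

/-- The integral `∫₁^∞ R(t) t^(-s-1) dt` attached to the remainder of a character sum. -/
noncomputable def charIntegral {q : ℕ} [NeZero q] (χ : DirichletCharacter ℂ q) (s : ℂ) : ℂ :=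
  ∫ t in Ioi (1 : ℝ), charRemainder χ t * (t : ℂ) ^ (-(s + 1))

lemma integrableOn_charRemainder {q : ℕ} [NeZero q] (χ : DirichletCharacter ℂ q) {s : ℂ}
    (hs : 0 < s.re) :
    IntegrableOn (fun t : ℝ => charRemainder χ t * (t : ℂ) ^ (-(s + 1))) (Ioi 1) := by
  have h1 : IntegrableOn (fun t : ℝ => (t : ℂ) ^ (-(s + 1))) (Ioi 1) :=
    integrableOn_Ioi_cpow_of_lt (by simp; linarith) one_pos
  refine Integrable.bdd_mul (c := 5 * q) h1
    (measurable_charRemainder χ).aestronglyMeasurable ?_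
  filter_upwards [ae_restrict_mem measurableSet_Ioi] with t ht
  exact norm_charRemainder_le χ (zero_le_one.trans (le_of_lt ht))

lemma norm_charIntegral_le {q : ℕ} [NeZero q] (χ : DirichletCharacter ℂ q) {s : ℂ}
    (hs : 0 < s.re) : ‖charIntegral χ s‖ ≤ 5 * q / s.re := by
  have hb : ∀ t ∈ Ioi (1 : ℝ), ‖charRemainder χ t * (t : ℂ) ^ (-(s + 1))‖
      ≤ 5 * q * t ^ (-(s.re + 1)) := by
    intro t ht
    have ht0 : (0 : ℝ) < t := zero_lt_one.trans ht
    rw [norm_mul, Complex.norm_cpow_eq_rpow_re_of_pos ht0]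
    have : (-(s + 1)).re = -(s.re + 1) := by simp
    rw [this]
    gcongr
    exact norm_charRemainder_le χ ht0.le
  have hi : IntegrableOn (fun t : ℝ => 5 * (q : ℝ) * t ^ (-(s.re + 1))) (Ioi 1) :=
    (integrableOn_Ioi_rpow_of_lt (by linarith) one_pos).const_mul _
  refine (norm_integral_le_of_norm_le hi ((ae_restrict_iff' measurableSet_Ioi).mpr
    (Eventually.of_forall hb))).trans (le_of_eq ?_)
  rw [integral_const_mul, integral_Ioi_rpow_of_lt (by linarith) one_pos]
  have : s.re ≠ 0 := hs.ne'
  simp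
  field_simp

lemma differentiableAt_charIntegral {q : ℕ} [NeZero q] (χ : DirichletCharacter ℂ q) {s : ℂ}
    (hs : 0 < s.re) : DifferentiableAt ℂ (charIntegral χ) s := by
  set f : ℝ → ℂ := (Ioi (1 : ℝ)).indicator (charRemainder χ) with hf
  have heq : charIntegral χ = fun s => mellin f (-s) := by
    funext s
    have h1 : ∀ t : ℝ, (t : ℂ) ^ (-s - 1) • f t
        = (Ioi (1 : ℝ)).indicator (fun t => charRemainder χ t * (t : ℂ) ^ (-(s + 1))) t := by
      intro t
      by_cases ht : t ∈ Ioi (1 : ℝ)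
      · simp only [hf, indicator_of_mem ht, smul_eq_mul]
        rw [mul_comm]; congr 2; ring
      · simp only [hf, indicator_of_notMem ht, smul_zero]
    rw [charIntegral, mellin]
    simp_rw [h1]
    rw [setIntegral_indicator measurableSet_Ioi]
    congr 2
    ext t; simp
  have hbd : ∀ t, 0 ≤ t → ‖f t‖ ≤ 5 * q := by
    intro t ht
    refine (norm_indicator_le_norm_self _ _).trans (norm_charRemainder_le χ ht)
  rw [heq]
  have hd : DifferentiableAt ℂ (mellin f) (-s) := by
    refine mellin_differentiableAt_of_isBigO_rpow (a := 0) (b := -s.re - 1) ?_ ?_ (by simpa using hs)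
      ?_ (by simp)
    · refine LocallyIntegrable.locallyIntegrableOn ?_ _
      have hm : Measurable f := (measurable_charRemainder χ).indicator measurableSet_Ioi
      refine (locallyIntegrable_const (5 * (q : ℝ))).mono hm.aestronglyMeasurable
        (Eventually.of_forall fun t => ?_)
      rw [Real.norm_of_nonneg (by positivity)]
      by_cases ht : t ∈ Ioi (1 : ℝ)
      · exact hbd t (by have : (1 : ℝ) < t := ht; linarith)
      · simp only [hf, indicator_of_notMem ht, norm_zero]; positivity
    · refine IsBigO.of_bound (5 * q) ?_
      filter_upwards [eventually_ge_atTop 0] with t ht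
      simpa using hbd t ht
    · refine IsBigO.of_bound 1 ?_
      filter_upwards [mem_nhdsWithin_of_mem_nhds (Iio_mem_nhds zero_lt_one)] with t ht
      have : t ∉ Ioi (1 : ℝ) := by simpa using le_of_lt ht
      simp only [hf, indicator_of_notMem this, norm_zero]; positivity
  exact hd.comp s differentiable_neg.differentiableAt

lemma LFunction_eq_charIntegral {q : ℕ} [NeZero q] (χ : DirichletCharacter ℂ q) {s : ℂ}
    (hs : 1 < s.re) :
    DirichletCharacter.LFunction χ s = charMean χ * s / (s - 1) + s * charIntegral χ s := by
  have h1 : (fun n : ℕ => ∑ k ∈ Finset.Icc 1 n, ‖χ k‖) =O[atTop] fun n => (n : ℝ) ^ (1 : ℝ) := by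
    refine IsBigO.of_bound 1 (Eventually.of_forall fun n => ?_)
    rw [Real.rpow_one, one_mul, Real.norm_natCast, Real.norm_of_nonneg (by positivity)]
    refine (Finset.sum_le_sum fun k _ => χ.norm_le_one _).trans ?_
    simp
  rw [DirichletCharacter.LFunction_eq_LSeries χ hs,
    LSeries_eq_mul_integral' (fun n : ℕ => χ n) zero_le_one hs h1]
  have hs1 : s - 1 ≠ 0 := by
    intro h; rw [sub_eq_zero.mp h] at hs; simp at hs
  have h2 : ∀ t ∈ Ioi (1 : ℝ), (∑ k ∈ Finset.Icc 1 ⌊t⌋₊, χ k) * (t : ℂ) ^ (-(s + 1))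
      = charMean χ * (t : ℂ) ^ (-s) + charRemainder χ t * (t : ℂ) ^ (-(s + 1)) := by
    intro t ht
    have ht0 : (t : ℂ) ≠ 0 := by
      have : (0 : ℝ) < t := zero_lt_one.trans ht
      exact_mod_cast this.ne'
    have h3 : (t : ℂ) ^ (-s) = t * (t : ℂ) ^ (-(s + 1)) := by
      have : -s = 1 + -(s + 1) := by ring
      conv_lhs => rw [this, Complex.cpow_add _ _ ht0, Complex.cpow_one]
    rw [h3, charRemainder]; ring
  rw [setIntegral_congr_fun measurableSet_Ioi h2, integral_add
    ((integrableOn_Ioi_cpow_of_lt (by simpa using hs) one_pos).const_mul _)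
    (integrableOn_charRemainder χ (by linarith)), integral_const_mul,
    integral_Ioi_cpow_of_lt (by simpa using hs) one_pos]
  have h4 : -s + 1 ≠ 0 := by
    intro h; apply hs1; linear_combination -h
  rw [mul_add]
  congr 1
  simp only [ofReal_one, one_cpow]
  rw [mul_div_assoc', mul_div_assoc', div_eq_div_iff h4 hs1]
  ring

/-- The Dirichlet L-function with its possible pole at `1` removed. -/
noncomputable def regularL {q : ℕ} [NeZero q] (χ : DirichletCharacter ℂ q) : ℂ → ℂ :=
  if χ = 1 then DirichletCharacter.LFunctionTrivChar₁ q else DirichletCharacter.LFunction χ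

lemma differentiable_regularL {q : ℕ} [NeZero q] (χ : DirichletCharacter ℂ q) :
    Differentiable ℂ (regularL χ) := by
  unfold regularL
  split_ifs with h
  · exact DirichletCharacter.differentiable_LFunctionTrivChar₁ q
  · exact DirichletCharacter.differentiable_LFunction h

lemma regularL_of_ne_one {q : ℕ} [NeZero q] (χ : DirichletCharacter ℂ q) {s : ℂ} (hs : s ≠ 1) :
    regularL χ s = (if χ = 1 then s - 1 else 1) * DirichletCharacter.LFunction χ s := by
  unfold regularL
  split_ifs with h
  · rw [h, DirichletCharacter.LFunctionTrivChar₁, Function.update_of_ne hs]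
  · rw [one_mul]

lemma regularL_eq_charIntegral {q : ℕ} [NeZero q] (χ : DirichletCharacter ℂ q) {s : ℂ}
    (hs : 0 < s.re) :
    regularL χ s = charMean χ * s + (if χ = 1 then s - 1 else 1) * (s * charIntegral χ s) := by
  set g : ℂ → ℂ := fun s =>
    charMean χ * s + (if χ = 1 then s - 1 else 1) * (s * charIntegral χ s) with hg
  have hopen : IsOpen {s : ℂ | 0 < s.re} := isOpen_lt continuous_const continuous_re
  have hgd : DifferentiableOn ℂ g {s : ℂ | 0 < s.re} := by
    intro s hs
    have h1 := differentiableAt_charIntegral χ hs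
    have h2 : DifferentiableAt ℂ (fun s : ℂ => if χ = 1 then s - 1 else 1) s := by
      split_ifs <;> fun_prop
    exact ((differentiableAt_id.const_mul _).add
      (h2.mul (differentiableAt_id.mul h1))).differentiableWithinAt
  have h2 : (2 : ℂ) ∈ {s : ℂ | 0 < s.re} := by simp
  refine AnalyticOnNhd.eqOn_of_preconnected_of_eventuallyEq
    ((differentiable_regularL χ).differentiableOn.analyticOnNhd hopen) (hgd.analyticOnNhd hopen)
    (convex_halfSpace_re_gt 0).isPreconnected h2 ?_ hs
  have hnhds : {s : ℂ | 1 < s.re} ∈ nhds (2 : ℂ) :=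
    (isOpen_lt continuous_const continuous_re).mem_nhds (by simp)
  filter_upwards [hnhds] with s hs
  have hs1 : s ≠ 1 := by rintro rfl; simp at hs
  rw [regularL_of_ne_one χ hs1, LFunction_eq_charIntegral χ hs, hg]
  have hs2 : s - 1 ≠ 0 := sub_ne_zero.mpr hs1
  split_ifs with h
  · field_simp
  · simp only [charMean_eq_zero h]; ring

lemma norm_regularL_le {q : ℕ} [NeZero q] (χ : DirichletCharacter ℂ q) {s : ℂ}
    (hs : 1 / 5 ≤ s.re) : ‖regularL χ s‖ ≤ 26 * q * (‖s‖ + 1) ^ 2 := by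
  have hs0 : 0 < s.re := by linarith
  have hq : (1 : ℝ) ≤ q := by exact_mod_cast NeZero.one_le
  rw [regularL_eq_charIntegral χ hs0]
  have h1 : ‖charIntegral χ s‖ ≤ 25 * q := by
    refine (norm_charIntegral_le χ hs0).trans ?_
    rw [div_le_iff₀ hs0]; nlinarith
  have h2 : ‖(if χ = 1 then s - 1 else 1 : ℂ)‖ ≤ ‖s‖ + 1 := by
    split_ifs
    · simpa using norm_sub_le s 1
    · simp
  have h3 : ‖charMean χ * s‖ ≤ ‖s‖ := by
    rw [norm_mul]
    exact mul_le_of_le_one_left (norm_nonneg _) (norm_charMean_le_one χ)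
  have h4 : ‖(if χ = 1 then s - 1 else 1 : ℂ) * (s * charIntegral χ s)‖
      ≤ (‖s‖ + 1) * (‖s‖ * (25 * q)) := by
    rw [norm_mul, norm_mul]; gcongr
  refine (norm_add_le _ _).trans ((add_le_add h3 h4).trans ?_)
  have hn := norm_nonneg s
  nlinarith [mul_nonneg hn (by linarith : (0 : ℝ) ≤ q - 1), sq_nonneg ‖s‖,
    mul_nonneg (sq_nonneg ‖s‖) (by linarith : (0 : ℝ) ≤ q)]

lemma le_norm_LFunction_two_add {q : ℕ} [NeZero q] (χ : DirichletCharacter ℂ q) {s : ℂ}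
    (hs : s.re = 2) : 3 / 10 ≤ ‖DirichletCharacter.LFunction χ s‖ := by
  have hs1 : 1 < s.re := by linarith
  rw [DirichletCharacter.LFunction_eq_LSeries χ hs1]
  have hsum : HasSum (fun n : ℕ => LSeries.term (fun n : ℕ => χ n) s n)
      (LSeries (fun n : ℕ => χ n) s) := (DirichletCharacter.LSeriesSummable_of_one_lt_re χ hs1).hasSum
  have hone : HasSum (fun n : ℕ => if n = 1 then (1 : ℂ) else 0) 1 := hasSum_ite_eq 1 1
  have honeR : HasSum (fun n : ℕ => if n = 1 then (1 : ℝ) else 0) 1 := hasSum_ite_eq 1 1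
  have hdiff := hsum.sub hone
  have hb := tsum_of_norm_bounded (hasSum_zeta_two.sub honeR) (f := fun n : ℕ =>
      LSeries.term (fun n : ℕ => χ n) s n - if n = 1 then (1 : ℂ) else 0) (by
    intro n
    rcases eq_or_ne n 0 with rfl | h0
    · simp
    rcases eq_or_ne n 1 with rfl | h1
    · simp [LSeries.term]
    · simp only [if_neg h1, sub_zero]
      rw [LSeries.norm_term_eq, if_neg h0, hs]
      have : ((n : ℝ) ^ (2 : ℝ)) = (n : ℝ) ^ 2 := by exact_mod_cast Real.rpow_natCast (n : ℝ) 2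
      rw [this]
      gcongr
      exact χ.norm_le_one _)
  rw [hdiff.tsum_eq] at hb
  have hpi : Real.pi ^ 2 / 6 - 1 ≤ 7 / 10 := by
    nlinarith [Real.pi_lt_d2, Real.pi_pos]
  have h3 : ‖(1 : ℂ)‖ ≤ ‖LSeries (fun n : ℕ => χ n) s‖ + ‖LSeries (fun n : ℕ => χ n) s - 1‖ := by
    have := norm_sub_le (LSeries (fun n : ℕ => χ n) s) (LSeries (fun n : ℕ => χ n) s - 1)
    simpa using this
  rw [norm_one] at h3
  linarith

lemma le_norm_regularL_two_add {q : ℕ} [NeZero q] (χ : DirichletCharacter ℂ q) {s : ℂ}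
    (hs : s.re = 2) : 3 / 10 ≤ ‖regularL χ s‖ := by
  have hs1 : s ≠ 1 := by rintro rfl; simp at hs
  rw [regularL_of_ne_one χ hs1, norm_mul]
  have h1 : 1 ≤ ‖(if χ = 1 then s - 1 else 1 : ℂ)‖ := by
    split_ifs
    · have := abs_re_le_norm (s - 1)
      simp only [sub_re, one_re, hs] at this
      norm_num at this
      exact this
    · simp
  have := le_norm_LFunction_two_add χ hs
  nlinarith [norm_nonneg (DirichletCharacter.LFunction χ s)]

/-- The local partial fraction expansion of `L'/L`, with error uniform in the modulus. -/
theorem exists_regularL_partial_fraction : ∃ C : ℝ, 0 < C ∧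
    ∀ (q : ℕ) [NeZero q] (χ : DirichletCharacter ℂ q) (T : ℝ), ∃ Z : Multiset ℂ,
      (∀ ρ ∈ Z, regularL χ ρ = 0 ∧ 0 < ρ.re) ∧
      (Multiset.card Z : ℝ) ≤ C * Real.log (q * (|T| + 2)) ∧
      ∀ z ∈ closedBall (2 + T * I : ℂ) (16 / 10), regularL χ z ≠ 0 →
        ‖logDeriv (regularL χ) z - (Z.map fun ρ => 1 / (z - ρ)).sum‖
          ≤ C * Real.log (q * (|T| + 2)) := by
  obtain ⟨C, hC, h⟩ := exists_logDeriv_partial_fraction (r' := 16 / 10) (r := 17 / 10)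
    (R := 18 / 10) (by norm_num) (by norm_num) (by norm_num)
  refine ⟨C * 16, by positivity, ?_⟩
  intro q _ χ T
  have hq : (1 : ℝ) ≤ q := by exact_mod_cast NeZero.one_le
  set Q : ℝ := q * (|T| + 2) with hQ
  have hT := abs_nonneg T
  have hQ2 : 2 ≤ Q := by nlinarith
  have hlog : 0 < Real.log Q := Real.log_pos (by linarith)
  have hcre : (2 + T * I : ℂ).re = 2 := by simp
  have hc := le_norm_regularL_two_add χ hcre
  have hball : ∀ (z : ℂ) (t : ℝ), z ∈ closedBall (2 + T * I : ℂ) t → 2 - t ≤ z.re := by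
    intro z t hz
    have h1 : ‖z - (2 + T * I)‖ ≤ t := by simpa [dist_eq_norm] using hz
    have h2 := (abs_le.mp ((abs_re_le_norm (z - (2 + T * I))).trans h1)).1
    simp at h2
    linarith
  obtain ⟨Z, hZ1, hZ2, hZ3⟩ := h (regularL χ) univ (2 + T * I) (16 * Real.log Q) isOpen_univ
    (subset_univ _) (differentiable_regularL χ).differentiableOn (by positivity)
    (by intro h0; rw [h0] at hc; norm_num at hc) (by
      intro z hz
      have hzre := hball z _ hz
      refine (norm_regularL_le χ (by linarith)).trans ?_
      have h1 : ‖z - (2 + T * I)‖ ≤ 18 / 10 := by simpa [dist_eq_norm] using hz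
      have h2 : ‖(2 + T * I : ℂ)‖ ≤ 2 + |T| := by
        refine (norm_add_le _ _).trans ?_
        simp
      have h3 : ‖z‖ ≤ |T| + 4 := by
        have := norm_le_norm_add_norm_sub' z (2 + T * I)
        linarith
      have hexp : Real.exp (16 * Real.log Q) = Q ^ 16 := by
        rw [mul_comm, Real.exp_mul, Real.exp_log (by linarith)]
        exact_mod_cast Real.rpow_natCast Q 16
      have h5 : (‖z‖ + 1) ^ 2 ≤ (3 * (|T| + 2)) ^ 2 := by gcongr; linarith
      have h6 : (q : ℝ) * (|T| + 2) ^ 2 ≤ Q ^ 2 := by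
        rw [hQ, mul_pow]; gcongr; nlinarith
      have h7 : (2 : ℝ) ^ 14 ≤ Q ^ 14 := by gcongr
      rw [hexp]
      calc 26 * (q : ℝ) * (‖z‖ + 1) ^ 2 ≤ 26 * q * (3 * (|T| + 2)) ^ 2 := by gcongr
        _ = 234 * (q * (|T| + 2) ^ 2) := by ring
        _ ≤ 234 * Q ^ 2 := by gcongr
        _ ≤ (2 ^ 14 * (3 / 10)) * Q ^ 2 := by gcongr; norm_num
        _ ≤ (Q ^ 14 * (3 / 10)) * Q ^ 2 := by gcongr
        _ = Q ^ 16 * (3 / 10) := by ring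
        _ ≤ _ := by gcongr)
  refine ⟨Z, fun ρ hρ => ⟨(hZ1 ρ hρ).1, ?_⟩, ?_, ?_⟩
  · have := hball ρ _ (hZ1 ρ hρ).2
    linarith
  · rw [mul_assoc]; exact hZ2
  · intro z hz hz0
    rw [mul_assoc]; exact hZ3 z hz hz0

end

section
open Complex Metric MeasureTheory Set Filter

lemma regularL_ne_zero (hGRH : GRH) {q : ℕ} [NeZero q] (χ : DirichletCharacter ℂ q) {s : ℂ}
    (hs : 1 / 2 < s.re) : regularL χ s ≠ 0 := by
  rcases eq_or_ne s 1 with rfl | hs1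
  · by_cases h : χ = 1
    · rw [regularL, if_pos h]
      exact DirichletCharacter.LFunctionTrivChar₁_apply_one_ne_zero q
    · rw [regularL, if_neg h]
      exact DirichletCharacter.LFunction_ne_zero_of_one_le_re χ (Or.inl h) le_rfl
  · rw [regularL_of_ne_one χ hs1]
    refine mul_ne_zero ?_ ?_
    · split_ifs
      · exact sub_ne_zero.mpr hs1
      · exact one_ne_zero
    · rcases lt_or_ge s.re 1 with h | h
      · intro h0
        have := hGRH q χ s (by linarith) h h0
        linarith
      · exact DirichletCharacter.LFunction_ne_zero_of_one_le_re χ (Or.inr hs1) h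

lemma differentiableAt_logDeriv_regularL (hGRH : GRH) {q : ℕ} [NeZero q]
    (χ : DirichletCharacter ℂ q) {s : ℂ} (hs : 1 / 2 < s.re) :
    DifferentiableAt ℂ (logDeriv (regularL χ)) s := by
  have hd := (differentiable_regularL χ).differentiableOn (s := univ)
  have h1 : DifferentiableAt ℂ (deriv (regularL χ)) s :=
    (hd.deriv isOpen_univ).differentiableAt univ_mem
  exact h1.div (differentiable_regularL χ s) (regularL_ne_zero hGRH χ hs)

lemma continuous_logDeriv_regularL_vertical (hGRH : GRH) {q : ℕ} [NeZero q]
    (χ : DirichletCharacter ℂ q) {σ : ℝ} (hσ : 1 / 2 < σ) :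
    Continuous fun t : ℝ => logDeriv (regularL χ) (σ + t * I) := by
  rw [continuous_iff_continuousAt]
  intro t
  have h1 : ContinuousAt (logDeriv (regularL χ)) (σ + t * I) :=
    (differentiableAt_logDeriv_regularL hGRH χ (by simpa using hσ)).continuousAt
  exact h1.comp (f := fun t : ℝ => (σ + t * I : ℂ)) (by fun_prop)

lemma mem_closedBall_two_add {s : ℂ} {T : ℝ} (h1 : 1 / 2 ≤ s.re) (h2 : s.re ≤ 3 / 2)
    (h3 : |s.im - T| ≤ 1 / 2) : s ∈ closedBall (2 + T * I : ℂ) (16 / 10) := by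
  rw [mem_closedBall, dist_eq_norm]
  refine abs_le_of_sq_le_sq' ?_ (by norm_num) |>.2
  rw [← Complex.normSq_eq_norm_sq, Complex.normSq_apply]
  simp only [sub_re, add_re, re_ofNat, mul_re, ofReal_re, I_re, mul_zero, ofReal_im, I_im, mul_one,
    sub_self, add_zero, sub_im, add_im, im_ofNat, mul_im, zero_add]
  have := abs_le.mp h3
  nlinarith

/-- The bound for `L'/L` to the right of the critical line. -/
theorem exists_norm_logDeriv_regularL_le (hGRH : GRH) : ∃ C : ℝ, 0 < C ∧
    ∀ (q : ℕ) [NeZero q] (χ : DirichletCharacter ℂ q) (δ : ℝ) (s : ℂ), 0 < δ → δ ≤ 1 →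
      1 / 2 + δ ≤ s.re → s.re ≤ 3 / 2 →
      ‖logDeriv (regularL χ) s‖ ≤ C / δ * Real.log (q * (|s.im| + 2)) := by
  obtain ⟨C, hC, h⟩ := exists_regularL_partial_fraction
  refine ⟨2 * C, by positivity, ?_⟩
  intro q _ χ δ s hδ hδ1 hs hs2
  obtain ⟨Z, hZ, hcard, hlog⟩ := h q χ s.im
  have hb := hlog s (mem_closedBall_two_add (by linarith) hs2 (by simp))
    (regularL_ne_zero hGRH χ (by linarith))
  set Q := Real.log (q * (|s.im| + 2))
  have hsum : ‖(Z.map fun ρ => 1 / (s - ρ)).sum‖ ≤ Multiset.card Z * (1 / δ) := by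
    have h1 : ‖(Z.map fun ρ => 1 / (s - ρ)).sum‖
        ≤ ((Z.map fun ρ => 1 / (s - ρ)).map fun z => ‖z‖).sum := norm_multiset_sum_le _
    refine h1.trans ?_
    rw [Multiset.map_map, ← nsmul_eq_mul]
    have := Multiset.sum_le_card_nsmul (Z.map fun ρ => ‖1 / (s - ρ)‖) (1 / δ) (by
      intro x hx
      obtain ⟨ρ, hρ, rfl⟩ := Multiset.mem_map.mp hx
      have hρ2 : ρ.re ≤ 1 / 2 := by
        by_contra hcon
        exact regularL_ne_zero hGRH χ (not_le.mp hcon) (hZ ρ hρ).1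
      rw [norm_div, norm_one]
      refine one_div_le_one_div_of_le hδ ?_
      have := re_le_norm (s - ρ)
      rw [sub_re] at this
      linarith)
    simpa using this
  have hQ : 0 ≤ C * Q := (Nat.cast_nonneg _).trans hcard
  have h2 : ‖logDeriv (regularL χ) s‖ ≤ C * Q + Multiset.card Z * (1 / δ) := by
    have := norm_le_norm_add_norm_sub' (logDeriv (regularL χ) s) (Z.map fun ρ => 1 / (s - ρ)).sum
    linarith
  refine h2.trans ?_
  have h3 : C * Q ≤ C * Q * (1 / δ) := le_mul_of_one_le_right hQ (by rw [le_div_iff₀ hδ]; linarith)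
  have h4 : Multiset.card Z * (1 / δ) ≤ C * Q * (1 / δ) := by gcongr
  calc _ ≤ C * Q * (1 / δ) + C * Q * (1 / δ) := add_le_add h3 h4
    _ = _ := by ring

lemma re_one_div_vertical_sub (σ t : ℝ) (ρ : ℂ) :
    (1 / (σ + t * I - ρ)).re = (σ - ρ.re) / ((σ - ρ.re) ^ 2 + (t - ρ.im) ^ 2) := by
  rw [one_div, inv_re, normSq_apply]
  simp [sq]

lemma integral_re_one_div_vertical_sub_le {σ : ℝ} {ρ : ℂ} (h : ρ.re < σ) (a b : ℝ) :
    ∫ t in a..b, (1 / (σ + t * I - ρ)).re ≤ Real.pi := by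
  have ha : 0 < σ - ρ.re := sub_pos.mpr h
  have hder : ∀ t ∈ uIcc a b, HasDerivAt (fun t : ℝ => Real.arctan ((t - ρ.im) / (σ - ρ.re)))
      ((1 / (σ + t * I - ρ)).re) t := by
    intro t _
    have h1 : HasDerivAt (fun t : ℝ => (t - ρ.im) / (σ - ρ.re)) (1 / (σ - ρ.re)) t :=
      ((hasDerivAt_id t).sub_const _).div_const _
    refine h1.arctan.congr_deriv ?_
    rw [re_one_div_vertical_sub]
    have : 0 < (σ - ρ.re) ^ 2 + (t - ρ.im) ^ 2 := by positivity
    field_simp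
  rw [intervalIntegral.integral_eq_sub_of_hasDerivAt hder ?_]
  · linarith [Real.arctan_lt_pi_div_two ((b - ρ.im) / (σ - ρ.re)),
      Real.neg_pi_div_two_lt_arctan ((a - ρ.im) / (σ - ρ.re))]
  · refine Continuous.intervalIntegrable ?_ _ _
    simp_rw [re_one_div_vertical_sub]
    refine Continuous.div₀ (by fun_prop) (by fun_prop) fun t => ?_
    positivity

lemma integral_re_sum_one_div_le {σ : ℝ} (Z : Multiset ℂ) (h : ∀ ρ ∈ Z, ρ.re < σ) (a b : ℝ) :
    (Continuous fun t : ℝ => (Z.map fun ρ => 1 / (σ + t * I - ρ)).sum.re) ∧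
    (∀ t : ℝ, 0 ≤ (Z.map fun ρ => 1 / (σ + t * I - ρ)).sum.re) ∧
    ∫ t in a..b, (Z.map fun ρ => 1 / (σ + t * I - ρ)).sum.re ≤ Multiset.card Z * Real.pi := by
  induction Z using Multiset.induction with
  | empty => simp [continuous_const]
  | cons ρ Z ih =>
    obtain ⟨h1, h2, h3⟩ := ih fun ρ' hρ' => h ρ' (Multiset.mem_cons_of_mem hρ')
    have hρ := h ρ (Multiset.mem_cons_self ρ Z)
    have ha : 0 < σ - ρ.re := sub_pos.mpr hρ
    have hc : Continuous fun t : ℝ => (1 / (σ + t * I - ρ)).re := by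
      simp_rw [re_one_div_vertical_sub]
      exact Continuous.div₀ (by fun_prop) (by fun_prop) fun t => by positivity
    simp only [Multiset.map_cons, Multiset.sum_cons, add_re, Multiset.card_cons]
    refine ⟨hc.add h1, fun t => add_nonneg ?_ (h2 t), ?_⟩
    · rw [re_one_div_vertical_sub]; positivity
    · rw [intervalIntegral.integral_add (hc.intervalIntegrable _ _) (h1.intervalIntegrable _ _)]
      push_cast
      linarith [integral_re_one_div_vertical_sub_le hρ a b]

/-- The real part of `L'/L` is bounded on average, uniformly up to the critical line. -/
theorem exists_integral_abs_re_logDeriv_regularL_le (hGRH : GRH) : ∃ C : ℝ, 0 < C ∧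
    ∀ (q : ℕ) [NeZero q] (χ : DirichletCharacter ℂ q) (σ T : ℝ), 1 / 2 < σ → σ ≤ 3 / 2 →
      ∫ t in (T - 1 / 2)..(T + 1 / 2), |(logDeriv (regularL χ) (σ + t * I)).re|
        ≤ C * Real.log (q * (|T| + 2)) := by
  obtain ⟨C, hC, h⟩ := exists_regularL_partial_fraction
  refine ⟨C * (1 + Real.pi), by positivity, ?_⟩
  intro q _ χ σ T hσ hσ1
  obtain ⟨Z, hZ, hcard, hlog⟩ := h q χ T
  set Q := Real.log (q * (|T| + 2))
  have hre : ∀ ρ ∈ Z, ρ.re < σ := by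
    intro ρ hρ
    by_contra hcon
    exact regularL_ne_zero hGRH χ (hσ.trans_le (not_lt.mp hcon)) (hZ ρ hρ).1
  obtain ⟨h1, h2, h3⟩ := integral_re_sum_one_div_le Z hre (T - 1 / 2) (T + 1 / 2)
  have hbound : ∀ t ∈ Icc (T - 1 / 2) (T + 1 / 2), |(logDeriv (regularL χ) (σ + t * I)).re|
      ≤ C * Q + (Z.map fun ρ => 1 / (σ + t * I - ρ)).sum.re := by
    intro t ht
    have hre : (σ + t * I : ℂ).re = σ := by simp
    have him : (σ + t * I : ℂ).im = t := by simp
    have hb := hlog (σ + t * I) (mem_closedBall_two_add (by rw [hre]; exact hσ.le)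
      (by rw [hre]; exact hσ1) (by rw [him, abs_le]; constructor <;> linarith [ht.1, ht.2]))
      (regularL_ne_zero hGRH χ (by rw [hre]; exact hσ))
    have h4 := (abs_re_le_norm _).trans hb
    rw [sub_re] at h4
    have h5 := h2 t
    rw [abs_le] at h4 ⊢
    constructor <;> linarith [h4.1, h4.2]
  calc _ ≤ ∫ t in (T - 1 / 2)..(T + 1 / 2),
        (C * Q + (Z.map fun ρ => 1 / (σ + t * I - ρ)).sum.re) := by
        refine intervalIntegral.integral_mono_on (by linarith) ?_ ?_ hbound
        · exact (continuous_re.comp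
            (continuous_logDeriv_regularL_vertical hGRH χ hσ)).abs.intervalIntegrable _ _
        · exact (continuous_const.add h1).intervalIntegrable _ _
    _ = C * Q + ∫ t in (T - 1 / 2)..(T + 1 / 2), (Z.map fun ρ => 1 / (σ + t * I - ρ)).sum.re := by
        rw [intervalIntegral.integral_add (by simp) (h1.intervalIntegrable _ _)]
        rw [intervalIntegral.integral_const, smul_eq_mul]
        ring
    _ ≤ C * Q + C * Q * Real.pi := by
        have := mul_le_mul_of_nonneg_right hcard Real.pi_pos.le
        linarith
    _ = _ := by ring

end

section
open Complex Metric MeasureTheory Set Filter Topology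

/-- The Mellin transform of `u ↦ max (y - u) 0`. -/
noncomputable def rieszKernel (y : ℝ) (s : ℂ) : ℂ := (y : ℂ) ^ (s + 1) / (s * (s + 1))

lemma one_div_norm_mul_norm_add_one_le {δ : ℝ} {s : ℂ} (hδ : 0 < δ) (hδ1 : δ ≤ 1)
    (hs : δ ≤ s.re) : 1 / (‖s‖ * ‖s + 1‖) ≤ 2 / δ * (1 / (1 + s.im ^ 2)) := by
  have h1 : δ ≤ ‖s‖ := hs.trans (re_le_norm s)
  have h2 : ‖s + 1‖ ≤ 2 / δ * ‖s‖ := by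
    have h3 : ‖s + 1‖ ≤ ‖s‖ + 1 := by simpa using norm_add_le s 1
    have h4 : 1 ≤ ‖s‖ / δ := by rwa [le_div_iff₀ hδ, one_mul]
    have h5 : ‖s‖ ≤ ‖s‖ / δ := le_div_self (norm_nonneg _) hδ hδ1
    calc _ ≤ ‖s‖ / δ + ‖s‖ / δ := by linarith
      _ = _ := by ring
  have h6 : 1 + s.im ^ 2 ≤ ‖s + 1‖ ^ 2 := by
    rw [← normSq_eq_norm_sq, normSq_apply]
    simp only [add_re, one_re, add_im, one_im, add_zero]
    nlinarith
  have hs0 : 0 < ‖s‖ := by linarith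
  have hs1 : 0 < ‖s + 1‖ := by
    by_contra hcon
    have : ‖s + 1‖ = 0 := le_antisymm (not_lt.mp hcon) (norm_nonneg _)
    rw [this] at h6
    nlinarith
  rw [mul_one_div, div_div, div_le_div_iff₀ (by positivity) (by positivity)]
  calc 1 * (δ * (1 + s.im ^ 2)) ≤ δ * ‖s + 1‖ ^ 2 := by rw [one_mul]; gcongr
    _ = δ * ‖s + 1‖ * ‖s + 1‖ := by ring
    _ ≤ δ * (2 / δ * ‖s‖) * ‖s + 1‖ := by gcongr
    _ = 2 * (‖s‖ * ‖s + 1‖) := by field_simp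

lemma norm_rieszKernel {y : ℝ} (hy : 0 < y) (s : ℂ) :
    ‖rieszKernel y s‖ = y ^ (s.re + 1) * (1 / (‖s‖ * ‖s + 1‖)) := by
  rw [rieszKernel, norm_div, norm_mul, norm_cpow_eq_rpow_re_of_pos hy]
  simp [div_eq_mul_inv]

lemma norm_rieszKernel_le {δ y : ℝ} {s : ℂ} (hy : 0 < y) (hδ : 0 < δ) (hδ1 : δ ≤ 1)
    (hs : δ ≤ s.re) : ‖rieszKernel y s‖ ≤ y ^ (s.re + 1) * (2 / δ * (1 / (1 + s.im ^ 2))) := by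
  rw [norm_rieszKernel hy]
  gcongr
  exact one_div_norm_mul_norm_add_one_le hδ hδ1 hs

lemma differentiableAt_rieszKernel {y : ℝ} {s : ℂ} (hy : 0 < y) (hs : 0 < s.re) :
    DifferentiableAt ℂ (rieszKernel y) s := by
  have hs0 : s ≠ 0 := by rintro rfl; simp at hs
  have hs1 : s + 1 ≠ 0 := by
    intro h
    have := congrArg re h
    simp at this
    linarith
  have hy0 : (y : ℂ) ≠ 0 := by exact_mod_cast hy.ne'
  unfold rieszKernel
  refine DifferentiableAt.div ?_ (by fun_prop) (mul_ne_zero hs0 hs1)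
  exact (by fun_prop : DifferentiableAt ℂ (fun s : ℂ => s + 1) s).const_cpow (Or.inl hy0)

lemma continuous_vertical {g : ℂ → ℂ} {c : ℝ} (hg : ∀ t : ℝ, DifferentiableAt ℂ g (c + t * I)) :
    Continuous fun t : ℝ => g (c + t * I) := by
  rw [continuous_iff_continuousAt]
  exact fun t => (hg t).continuousAt.comp (f := fun t : ℝ => (c + t * I : ℂ)) (by fun_prop)

lemma integrable_rieszKernel {y c : ℝ} (hy : 0 < y) (hc : 0 < c) :
    Integrable fun t : ℝ => rieszKernel y (c + t * I) := by
  have hbd : Integrable fun t : ℝ => y ^ (c + 1) * (2 / min c 1 * (1 / (1 + t ^ 2))) := by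
    simpa using (integrable_inv_one_add_sq.const_mul _).const_mul _
  refine hbd.mono' (continuous_vertical fun t =>
    differentiableAt_rieszKernel hy (by simpa using hc)).aestronglyMeasurable ?_
  filter_upwards with t
  simpa using norm_rieszKernel_le (s := c + t * I) hy (lt_min hc one_pos) (min_le_right c 1)
    (by simp)

lemma HasMellin.congr {f g : ℝ → ℂ} {s m : ℂ} (hf : HasMellin f s m)
    (h : ∀ u, 0 < u → f u = g u) : HasMellin g s m := by
  have h' : EqOn (fun u : ℝ => (u : ℂ) ^ (s - 1) • f u) (fun u : ℝ => (u : ℂ) ^ (s - 1) • g u)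
      (Ioi 0) := fun u hu => by simp only [h u hu]
  refine ⟨IntegrableOn.congr_fun hf.1 h' measurableSet_Ioi, ?_⟩
  rw [← hf.2]
  exact (setIntegral_congr_fun measurableSet_Ioi h').symm

lemma hasMellin_max_one_sub {s : ℂ} (hs : 0 < s.re) :
    HasMellin (fun u : ℝ => ((max (1 - u) 0 : ℝ) : ℂ)) s (1 / (s * (s + 1))) := by
  have h1 := hasMellin_cpow_Ioc 0 (s := s) (by simpa using hs)
  have h2 := hasMellin_cpow_Ioc 1 (s := s) (by simp; linarith)
  have h3 := hasMellin_sub h1.1 h2.1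
  have hs0 : s ≠ 0 := by rintro rfl; simp at hs
  have hs1 : s + 1 ≠ 0 := by
    intro h
    have := congrArg re h
    simp at this
    linarith
  rw [h1.2, h2.2] at h3
  have hval : 1 / (s + 0) - 1 / (s + 1) = 1 / (s * (s + 1)) := by
    rw [add_zero]; field_simp; ring
  rw [hval] at h3
  refine h3.congr fun u hu => ?_
  by_cases hu1 : u ≤ 1
  · have hmem : u ∈ Ioc (0 : ℝ) 1 := ⟨hu, hu1⟩
    simp [indicator_of_mem hmem, max_eq_left (sub_nonneg.mpr hu1)]
  · have hmem : u ∉ Ioc (0 : ℝ) 1 := fun h => hu1 h.2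
    simp [indicator_of_notMem hmem, max_eq_right (sub_nonpos.mpr (not_le.mp hu1).le)]

lemma hasMellin_max_one_sub_sq_div {s : ℂ} (hs : 1 < s.re) :
    HasMellin (fun u : ℝ => ((max (1 - u) 0 ^ 2 / (2 * u) : ℝ) : ℂ)) s
      (1 / (s * (s + 1)) / (s - 1)) := by
  have h0 := hasMellin_cpow_Ioc (-1) (s := s) (by simpa using hs)
  have h1 := hasMellin_cpow_Ioc 0 (s := s) (by simp; linarith)
  have h2 := hasMellin_cpow_Ioc 1 (s := s) (by simp; linarith)
  have h3 := hasMellin_add (h0.1.const_smul (1 / 2 : ℂ)) (h2.1.const_smul (1 / 2 : ℂ))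
  have h4 := hasMellin_sub h3.1 h1.1
  have hs0 : s ≠ 0 := by rintro rfl; simp at hs; linarith
  have hs1 : s + 1 ≠ 0 := by
    intro h
    have := congrArg re h
    simp at this
    linarith
  have hs2 : s - 1 ≠ 0 := by
    intro h
    have := congrArg re h
    simp at this
    linarith
  rw [h3.2, mellin_const_smul, mellin_const_smul, h0.2, h1.2, h2.2] at h4
  have hval : (1 / 2 : ℂ) • (1 / (s + -1)) + (1 / 2 : ℂ) • (1 / (s + 1)) - 1 / (s + 0)
      = 1 / (s * (s + 1)) / (s - 1) := by
    rw [add_zero, ← sub_eq_add_neg, smul_eq_mul, smul_eq_mul]; field_simp; ring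
  rw [hval] at h4
  refine h4.congr fun u hu => ?_
  have hu0 : (u : ℂ) ≠ 0 := by exact_mod_cast hu.ne'
  by_cases hu1 : u ≤ 1
  · have hmem : u ∈ Ioc (0 : ℝ) 1 := ⟨hu, hu1⟩
    simp only [indicator_of_mem hmem, max_eq_left (sub_nonneg.mpr hu1), cpow_neg_one, cpow_one,
      cpow_zero, smul_eq_mul]
    push_cast
    field_simp
    ring
  · have hmem : u ∉ Ioc (0 : ℝ) 1 := fun h => hu1 h.2
    simp [indicator_of_notMem hmem, max_eq_right (sub_nonpos.mpr (not_le.mp hu1).le)]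

lemma rieszKernel_one (s : ℂ) : rieszKernel 1 s = 1 / (s * (s + 1)) := by
  simp [rieszKernel]

lemma rieszKernel_eq {y : ℝ} (hy : 0 < y) (s : ℂ) :
    rieszKernel y s = y * ((1 / y : ℝ) : ℂ) ^ (-s) * rieszKernel 1 s := by
  have hy0 : (y : ℂ) ≠ 0 := by exact_mod_cast hy.ne'
  rw [rieszKernel_one, rieszKernel, cpow_add _ _ hy0, cpow_one, one_div y, ofReal_inv,
    inv_cpow _ _ (by rw [arg_ofReal_of_nonneg hy.le]; exact Real.pi_pos.ne), cpow_neg, inv_inv]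
  ring

lemma integral_cpow_mul_rieszKernel {c y u : ℝ} (hc : 0 < c) (hy : 0 < y) (hu : 0 < u) :
    ∫ t : ℝ, (u : ℂ) ^ (-(c + t * I)) * rieszKernel y (c + t * I)
      = 2 * Real.pi * (max (y - u) 0 : ℝ) := by
  have hm : ∀ t : ℝ, mellin (fun u : ℝ => ((max (1 - u) 0 : ℝ) : ℂ)) (c + t * I)
      = rieszKernel 1 (c + t * I) := fun t => by
    rw [(hasMellin_max_one_sub (by simpa using hc)).2, rieszKernel_one]
  have hinv := mellinInv_mellin_eq c (fun u : ℝ => ((max (1 - u) 0 : ℝ) : ℂ)) (x := u / y)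
    (by positivity) (hasMellin_max_one_sub (by simpa using hc)).1 (by
      rw [VerticalIntegrable]
      simp_rw [hm]
      exact integrable_rieszKernel one_pos hc) (by fun_prop)
  rw [mellinInv] at hinv
  simp_rw [hm] at hinv
  have hpi : (2 * Real.pi : ℝ) ≠ 0 := by positivity
  have h1 : ∀ t : ℝ, (u : ℂ) ^ (-(c + t * I)) * rieszKernel y (c + t * I)
      = y * (((u / y : ℝ) : ℂ) ^ (-(c + t * I)) • rieszKernel 1 (c + t * I)) := by
    intro t
    rw [rieszKernel_eq hy, div_eq_mul_one_div u y, ofReal_mul,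
      mul_cpow_ofReal_nonneg hu.le (by positivity), smul_eq_mul]
    ring
  simp_rw [h1]
  rw [integral_const_mul]
  have h2 : ∫ t : ℝ, ((u / y : ℝ) : ℂ) ^ (-(c + t * I)) • rieszKernel 1 (c + t * I)
      = (2 * Real.pi : ℝ) • ((max (1 - u / y) 0 : ℝ) : ℂ) := by
    rw [← hinv, smul_smul, mul_one_div_cancel hpi, one_smul]
  rw [h2]
  have h3 : max (y - u) 0 = y * max (1 - u / y) 0 := by
    rw [mul_max_of_nonneg _ _ hy.le]
    congr 1
    · field_simp
    · simp
  rw [h3, real_smul]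
  push_cast
  ring

lemma integral_rieszKernel_div {c y : ℝ} (hc : 1 < c) (hy : 1 ≤ y) :
    ∫ t : ℝ, rieszKernel y (c + t * I) / (c + t * I - 1) = Real.pi * ((y - 1) ^ 2 : ℝ) := by
  have hy0 : 0 < y := by linarith
  have hm : ∀ t : ℝ, mellin (fun u : ℝ => ((max (1 - u) 0 ^ 2 / (2 * u) : ℝ) : ℂ)) (c + t * I)
      = rieszKernel 1 (c + t * I) / (c + t * I - 1) := fun t => by
    rw [(hasMellin_max_one_sub_sq_div (by simpa using hc)).2, rieszKernel_one]
  have hne : ∀ t : ℝ, (c + t * I - 1 : ℂ) ≠ 0 := by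
    intro t h
    have := congrArg re h
    simp at this
    linarith
  have hinv := mellinInv_mellin_eq c (fun u : ℝ => ((max (1 - u) 0 ^ 2 / (2 * u) : ℝ) : ℂ))
    (x := 1 / y) (by positivity) (hasMellin_max_one_sub_sq_div (by simpa using hc)).1 (by
      rw [VerticalIntegrable]
      simp_rw [hm]
      refine ((integrable_rieszKernel one_pos (by linarith : 0 < c)).norm.const_mul
        (1 / (c - 1))).mono' ?_ ?_
      · refine Continuous.aestronglyMeasurable (Continuous.div₀ (continuous_vertical fun t =>
          differentiableAt_rieszKernel one_pos (by simp; linarith)) (by fun_prop) hne)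
      · filter_upwards with t
        rw [norm_div, div_eq_mul_one_div, mul_comm]
        have : c - 1 ≤ ‖(c + t * I - 1 : ℂ)‖ := by simpa using re_le_norm (c + t * I - 1 : ℂ)
        have hc1 : 0 < c - 1 := by linarith
        gcongr) (by
      refine ContinuousAt.comp (g := fun r : ℝ => (r : ℂ)) (by fun_prop) ?_
      have : (2 * (1 / y) : ℝ) ≠ 0 := by positivity
      exact ContinuousAt.div₀ (by fun_prop) (by fun_prop) this)
  rw [mellinInv] at hinv
  simp_rw [hm] at hinv
  have hpi : (2 * Real.pi : ℝ) ≠ 0 := by positivity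
  have h1 : ∀ t : ℝ, rieszKernel y (c + t * I) / (c + t * I - 1)
      = y * (((1 / y : ℝ) : ℂ) ^ (-(c + t * I)) •
        (rieszKernel 1 (c + t * I) / (c + t * I - 1))) := by
    intro t
    rw [rieszKernel_eq hy0, smul_eq_mul]
    ring
  simp_rw [h1]
  rw [integral_const_mul]
  have h2 : ∫ t : ℝ, ((1 / y : ℝ) : ℂ) ^ (-(c + t * I)) •
        (rieszKernel 1 (c + t * I) / (c + t * I - 1))
      = (2 * Real.pi : ℝ) • ((max (1 - 1 / y) 0 ^ 2 / (2 * (1 / y)) : ℝ) : ℂ) := by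
    rw [← hinv, smul_smul, mul_one_div_cancel hpi, one_smul]
  rw [h2, max_eq_left (by rw [sub_nonneg, div_le_one hy0]; exact hy), real_smul]
  have hyc : (y : ℂ) ≠ 0 := by exact_mod_cast hy0.ne'
  push_cast
  field_simp

end

section
open scoped Classical ComplexConjugate
open Complex Metric MeasureTheory Set Filter Topology

lemma integrable_one_add_sq_rpow : Integrable fun t : ℝ => (1 + t ^ 2) ^ (-(3 / 4) : ℝ) := by
  have h := integrable_rpow_neg_one_add_norm_sq (E := ℝ) (μ := volume) (r := 3 / 2)
    (by simp; norm_num)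
  refine h.congr (Eventually.of_forall fun t => ?_)
  simp only [Real.norm_eq_abs, sq_abs]
  norm_num

lemma tendsto_one_add_sq_rpow (D : ℝ) :
    Tendsto (fun t : ℝ => D * (1 + t ^ 2) ^ (-(3 / 4) : ℝ)) atTop (𝓝 0) := by
  have h1 : Tendsto (fun t : ℝ => 1 + t ^ 2) atTop atTop :=
    tendsto_atTop_add_const_left _ _ (tendsto_pow_atTop two_ne_zero)
  simpa using ((tendsto_rpow_neg_atTop (by norm_num : (0 : ℝ) < 3 / 4)).comp h1).const_mul D

lemma integrable_vertical {g : ℂ → ℂ} {c D : ℝ} (hd : ∀ t : ℝ, DifferentiableAt ℂ g (c + t * I))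
    (hD : ∀ t : ℝ, ‖g (c + t * I)‖ ≤ D * (1 + t ^ 2) ^ (-(3 / 4) : ℝ)) :
    Integrable fun t : ℝ => g (c + t * I) :=
  (integrable_one_add_sq_rpow.const_mul D).mono' (continuous_vertical hd).aestronglyMeasurable
    (Eventually.of_forall hD)

/-- Moving a vertical line of integration. -/
lemma integral_vertical_eq {g : ℂ → ℂ} {a b D : ℝ} (hab : a ≤ b)
    (hd : ∀ s : ℂ, a ≤ s.re → s.re ≤ b → DifferentiableAt ℂ g s)
    (hD : ∀ s : ℂ, a ≤ s.re → s.re ≤ b → ‖g s‖ ≤ D * (1 + s.im ^ 2) ^ (-(3 / 4) : ℝ)) :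
    ∫ t : ℝ, g (a + t * I) = ∫ t : ℝ, g (b + t * I) := by
  have hrea (t : ℝ) : (a + t * I : ℂ).re = a := by simp
  have hreb (t : ℝ) : (b + t * I : ℂ).re = b := by simp
  have hia : Integrable fun t : ℝ => g (a + t * I) := integrable_vertical (D := D)
    (fun t => hd _ (hrea t).ge (by rw [hrea t]; exact hab))
    (fun t => by simpa using hD (a + t * I) (hrea t).ge (by rw [hrea t]; exact hab))
  have hib : Integrable fun t : ℝ => g (b + t * I) := integrable_vertical (D := D)
    (fun t => hd _ (by rw [hreb t]; exact hab) (hreb t).le)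
    (fun t => by simpa using hD (b + t * I) (by rw [hreb t]; exact hab) (hreb t).le)
  have hta := intervalIntegral_tendsto_integral hia tendsto_neg_atTop_atBot tendsto_id
  have htb := intervalIntegral_tendsto_integral hib tendsto_neg_atTop_atBot tendsto_id
  have hhor : ∀ T : ℝ, ‖∫ x in a..b, g (x + T * I)‖ ≤ D * (1 + T ^ 2) ^ (-(3 / 4) : ℝ) * (b - a) := by
    intro T
    have := intervalIntegral.norm_integral_le_of_norm_le_const (a := a) (b := b)
      (f := fun x : ℝ => g (x + T * I)) (C := D * (1 + T ^ 2) ^ (-(3 / 4) : ℝ)) (by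
        intro x hx
        rw [uIoc_of_le hab] at hx
        simpa using hD (x + T * I) (by simpa using hx.1.le) (by simpa using hx.2))
    rwa [abs_of_nonneg (sub_nonneg.mpr hab)] at this
  have h0 := (tendsto_one_add_sq_rpow D).mul_const (b - a)
  rw [zero_mul] at h0
  have hup : Tendsto (fun T : ℝ => ∫ x in a..b, g (x + T * I)) atTop (𝓝 0) :=
    squeeze_zero_norm hhor h0
  have hdown : Tendsto (fun T : ℝ => ∫ x in a..b, g (x + (-T : ℝ) * I)) atTop (𝓝 0) :=
    squeeze_zero_norm (fun T => by simpa using hhor (-T)) h0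
  have hrect : ∀ T : ℝ, (∫ x in a..b, g (x + (-T : ℝ) * I)) - (∫ x in a..b, g (x + T * I))
      + I • (∫ t in (-T)..T, g (b + t * I)) - I • (∫ t in (-T)..T, g (a + t * I)) = 0 := by
    intro T
    have := Complex.integral_boundary_rect_eq_zero_of_differentiableOn g (a + (-T : ℝ) * I)
      (b + T * I) (by
        intro s hs
        rw [mem_reProdIm] at hs
        have h1 := hs.1
        rw [hrea, hreb, uIcc_of_le hab] at h1
        exact (hd s h1.1 h1.2).differentiableWithinAt)
    simpa using this
  have hlim := ((hdown.sub hup).add (htb.const_smul I)).sub (hta.const_smul I)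
  simp only [id] at hlim
  have hzero := tendsto_nhds_unique (hlim.congr hrect) tendsto_const_nhds
  rw [sub_zero, zero_add, ← smul_sub, smul_eq_zero_iff_right I_ne_zero, sub_eq_zero] at hzero
  exact hzero.symm

lemma log_mul_abs_add_two_le {q : ℝ} (hq : 0 ≤ q) (t : ℝ) :
    Real.log (q * (|t| + 2)) ≤ 2 * (3 * q) ^ (1 / 2 : ℝ) * (1 + t ^ 2) ^ (1 / 4 : ℝ) := by
  have h1 : |t| + 2 ≤ 3 * (1 + t ^ 2) ^ (1 / 2 : ℝ) := by
    rw [← Real.sqrt_eq_rpow]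
    have h2 : |t| ≤ Real.sqrt (1 + t ^ 2) := Real.abs_le_sqrt (by linarith)
    have h3 : 1 ≤ Real.sqrt (1 + t ^ 2) := by rw [Real.one_le_sqrt]; nlinarith
    linarith
  have h4 := Real.log_le_rpow_div (x := q * (|t| + 2)) (by positivity) (by norm_num : (0 : ℝ) < 1 / 2)
  refine h4.trans ?_
  have h5 : (q * (|t| + 2)) ^ (1 / 2 : ℝ) ≤ ((3 * q) * (1 + t ^ 2) ^ (1 / 2 : ℝ)) ^ (1 / 2 : ℝ) := by
    refine Real.rpow_le_rpow (by positivity) ?_ (by norm_num)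
    nlinarith
  rw [Real.mul_rpow (x := 3 * q) (by positivity) (by positivity),
    ← Real.rpow_mul (by positivity)] at h5
  have h6 : (1 / 2 * (1 / 2) : ℝ) = 1 / 4 := by norm_num
  rw [h6] at h5
  linarith

/-- The Mellin transform of the weight which is `1` on `(0, x]`, vanishes on `[x + h, ∞)` and is
linear in between. -/
noncomputable def trapezoidKernel (x h : ℝ) (s : ℂ) : ℂ :=
  (rieszKernel (x + h) s - rieszKernel x s) / h

lemma differentiableAt_trapezoidKernel {x h : ℝ} {s : ℂ} (hx : 0 < x) (hh : 0 < h)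
    (hs : 0 < s.re) : DifferentiableAt ℂ (trapezoidKernel x h) s :=
  ((differentiableAt_rieszKernel (by linarith) hs).sub
    (differentiableAt_rieszKernel hx hs)).div_const _

lemma norm_trapezoidKernel_le {x h : ℝ} {s : ℂ} (hx : 0 < x) (hh : 0 < h) (hs : 0 < s.re) :
    ‖trapezoidKernel x h s‖ ≤ 2 * (x + h) ^ (s.re + 1) / h * (1 / (‖s‖ * ‖s + 1‖)) := by
  rw [trapezoidKernel, norm_div, norm_real, Real.norm_of_nonneg hh.le]
  have h1 := norm_rieszKernel (by linarith : 0 < x + h) s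
  have h2 := norm_rieszKernel hx s
  have h3 := norm_sub_le (rieszKernel (x + h) s) (rieszKernel x s)
  have h4 : x ^ (s.re + 1) ≤ (x + h) ^ (s.re + 1) :=
    Real.rpow_le_rpow hx.le (by linarith) (by linarith)
  have h5 : 0 ≤ 1 / (‖s‖ * ‖s + 1‖) := by positivity
  have h6 := mul_le_mul_of_nonneg_right h4 h5
  calc _ ≤ (2 * (x + h) ^ (s.re + 1) * (1 / (‖s‖ * ‖s + 1‖))) / h := by gcongr; linarith
    _ = _ := by ring

lemma norm_trapezoidKernel_le_of_le_re {x h δ : ℝ} {s : ℂ} (hx : 0 < x) (hh : 0 < h) (hδ : 0 < δ)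
    (hδ1 : δ ≤ 1) (hs : δ ≤ s.re) :
    ‖trapezoidKernel x h s‖ ≤ 4 * (x + h) ^ (s.re + 1) / (h * δ) * (1 / (1 + s.im ^ 2)) := by
  have hxh : 0 < x + h := by linarith
  refine (norm_trapezoidKernel_le hx hh (by linarith)).trans ?_
  calc _ ≤ 2 * (x + h) ^ (s.re + 1) / h * (2 / δ * (1 / (1 + s.im ^ 2))) := by
        gcongr
        exact one_div_norm_mul_norm_add_one_le hδ hδ1 hs
    _ = _ := by field_simp; ring

lemma rieszKernel_conj {y : ℝ} (hy : 0 < y) (s : ℂ) :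
    rieszKernel y (conj s) = conj (rieszKernel y s) := by
  have h1 : conj s + 1 = conj (s + 1) := by simp
  rw [rieszKernel, rieszKernel, h1, cpow_conj _ _ (by
    rw [arg_ofReal_of_nonneg hy.le]; exact Real.pi_pos.ne), conj_ofReal, map_div₀, map_mul]

lemma trapezoidKernel_conj {x h : ℝ} (hx : 0 < x) (hh : 0 < h) (s : ℂ) :
    trapezoidKernel x h (conj s) = conj (trapezoidKernel x h s) := by
  rw [trapezoidKernel, trapezoidKernel, rieszKernel_conj hx, rieszKernel_conj (by linarith),
    map_div₀, map_sub, conj_ofReal]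

/-- The integral against a kernel is controlled by the integral against the conjugate kernel
and the real part of the integrand. -/
lemma norm_integral_mul_le {F K : ℝ → ℂ} (h1 : Integrable fun t => F t * K t)
    (h2 : Integrable fun t => F t * conj (K t)) :
    ‖∫ t, F t * K t‖ ≤ ‖∫ t, F t * conj (K t)‖ + 2 * ∫ t, |(F t).re| * ‖K t‖ := by
  have h3 : Integrable fun t => conj (F t * conj (K t)) :=
    (conjCLE : ℂ →L[ℝ] ℂ).integrable_comp h2
  have h4 : ∫ t, conj (F t * conj (K t)) = conj (∫ t, F t * conj (K t)) := integral_conj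
  have h5 : (∫ t, F t * K t) = (∫ t, (2 * (F t).re : ℂ) * K t) - conj (∫ t, F t * conj (K t)) := by
    rw [eq_sub_iff_add_eq, ← h4, ← integral_add h1 h3]
    refine integral_congr_ae (Eventually.of_forall fun t => ?_)
    simp only [map_mul, conj_conj]
    rw [← add_mul, add_conj]
    push_cast
    ring
  have h6 : ‖∫ t, (2 * (F t).re : ℂ) * K t‖ ≤ 2 * ∫ t, |(F t).re| * ‖K t‖ := by
    refine (norm_integral_le_integral_norm _).trans (le_of_eq ?_)
    rw [← integral_const_mul]
    refine integral_congr_ae (Eventually.of_forall fun t => ?_)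
    simp [mul_assoc]
  rw [h5]
  refine (norm_sub_le _ _).trans ?_
  rw [RCLike.norm_conj]
  linarith

end

section
open scoped Classical ComplexConjugate
open Complex Metric MeasureTheory Set Filter Topology

lemma norm_rpow_mul_trapezoidKernel_le {x h δ B : ℝ} {z s s' : ℂ} (hx : 1 ≤ x) (hh : 0 < h)
    (hδ : 0 < δ) (hδ1 : δ ≤ 1) (hs : δ ≤ s'.re) (hs' : s'.re ≤ 3 / 2) (him : s'.im ^ 2 = s.im ^ 2)
    (hz : ‖z‖ ≤ B * (1 + s.im ^ 2) ^ (1 / 4 : ℝ)) :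
    ‖z * trapezoidKernel x h s'‖
      ≤ B * (4 * (x + h) ^ (5 / 2 : ℝ) / (h * δ)) * (1 + s.im ^ 2) ^ (-(3 / 4) : ℝ) := by
  have hxh : 1 ≤ x + h := by linarith
  have h1 : (x + h) ^ (s'.re + 1) ≤ (x + h) ^ (5 / 2 : ℝ) :=
    Real.rpow_le_rpow_of_exponent_le hxh (by linarith)
  have h2 : ‖trapezoidKernel x h s'‖
      ≤ 4 * (x + h) ^ (5 / 2 : ℝ) / (h * δ) * (1 / (1 + s.im ^ 2)) := by
    refine (norm_trapezoidKernel_le_of_le_re (by linarith) hh hδ hδ1 hs).trans ?_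
    rw [him]
    gcongr
  have h3 : (1 + s.im ^ 2) ^ (-(3 / 4) : ℝ)
      = (1 + s.im ^ 2) ^ (1 / 4 : ℝ) * (1 / (1 + s.im ^ 2)) := by
    rw [one_div (1 + s.im ^ 2), ← Real.rpow_neg_one, ← Real.rpow_add (by positivity)]
    norm_num
  rw [norm_mul, h3]
  refine (mul_le_mul hz h2 (norm_nonneg _) ((norm_nonneg _).trans hz)).trans (le_of_eq ?_)
  ring

/-- Shift of the line of integration to the neighbourhood of the critical line, where only the
real part of `L'/L` matters up to a reflected integral on the original line. -/
theorem norm_integral_logDeriv_mul_trapezoidKernel_le (hGRH : GRH) {q : ℕ} [NeZero q]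
    (χ : DirichletCharacter ℂ q) {x h δ : ℝ} (hx : 1 ≤ x) (hh : 0 < h) (hδ : 0 < δ)
    (hδ1 : δ ≤ 1 / 2) :
    Integrable (fun t : ℝ => |(logDeriv (regularL χ) ((1 / 2 + δ : ℝ) + t * I)).re| *
      ‖trapezoidKernel x h ((1 / 2 + δ : ℝ) + t * I)‖) ∧
    ‖∫ t : ℝ, logDeriv (regularL χ) ((1 + δ : ℝ) + t * I) *
        trapezoidKernel x h ((1 + δ : ℝ) + t * I)‖
      ≤ ‖∫ t : ℝ, logDeriv (regularL χ) ((1 + δ : ℝ) + t * I) * trapezoidKernel x h (δ - t * I)‖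
        + 2 * ∫ t : ℝ, |(logDeriv (regularL χ) ((1 / 2 + δ : ℝ) + t * I)).re| *
          ‖trapezoidKernel x h ((1 / 2 + δ : ℝ) + t * I)‖ := by
  obtain ⟨C, hC, hlog⟩ := exists_norm_logDeriv_regularL_le hGRH
  set F := logDeriv (regularL χ) with hF
  set K := trapezoidKernel x h with hK
  have hx0 : 0 < x := by linarith
  set B : ℝ := C / δ * (2 * (3 * q) ^ (1 / 2 : ℝ)) with hB
  have hFb : ∀ s : ℂ, 1 / 2 + δ ≤ s.re → s.re ≤ 1 + δ →
      ‖F s‖ ≤ B * (1 + s.im ^ 2) ^ (1 / 4 : ℝ) := by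
    intro s h1 h2
    refine (hlog q χ δ s hδ (by linarith) h1 (by linarith)).trans ?_
    rw [hB, mul_assoc]
    gcongr
    exact log_mul_abs_add_two_le (Nat.cast_nonneg q) s.im
  have hFd : ∀ s : ℂ, 1 / 2 + δ ≤ s.re → DifferentiableAt ℂ F s := fun s h1 =>
    differentiableAt_logDeriv_regularL hGRH χ (by linarith)
  set D := B * (4 * (x + h) ^ (5 / 2 : ℝ) / (h * δ)) with hD
  have hId : ∀ s : ℂ, 1 / 2 + δ ≤ s.re → s.re ≤ 1 + δ →
      DifferentiableAt ℂ (fun s => F s * K s) s := fun s h1 h2 =>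
    (hFd s h1).mul (differentiableAt_trapezoidKernel hx0 hh (by linarith))
  have hIb : ∀ s : ℂ, 1 / 2 + δ ≤ s.re → s.re ≤ 1 + δ →
      ‖F s * K s‖ ≤ D * (1 + s.im ^ 2) ^ (-(3 / 4) : ℝ) := fun s h1 h2 =>
    norm_rpow_mul_trapezoidKernel_le hx hh hδ (by linarith) (by linarith) (by linarith) rfl
      (hFb s h1 h2)
  have hJd : ∀ s : ℂ, 1 / 2 + δ ≤ s.re → s.re ≤ 1 + δ →
      DifferentiableAt ℂ (fun s => F s * K (1 + 2 * δ - s)) s := by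
    intro s h1 h2
    refine (hFd s h1).mul ?_
    refine DifferentiableAt.comp s (g := K) (f := fun s : ℂ => 1 + 2 * δ - s)
      (differentiableAt_trapezoidKernel hx0 hh ?_) (by fun_prop)
    simp
    linarith
  have hJb : ∀ s : ℂ, 1 / 2 + δ ≤ s.re → s.re ≤ 1 + δ →
      ‖F s * K (1 + 2 * δ - s)‖ ≤ D * (1 + s.im ^ 2) ^ (-(3 / 4) : ℝ) := fun s h1 h2 =>
    norm_rpow_mul_trapezoidKernel_le hx hh hδ (by linarith) (by simp; linarith)
      (by simp; linarith) (by simp) (hFb s h1 h2)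
  have hle : (1 / 2 + δ : ℝ) ≤ 1 + δ := by linarith
  have hI := integral_vertical_eq hle hId hIb
  have hJ := integral_vertical_eq hle hJd hJb
  have hre : ∀ t : ℝ, ((1 / 2 + δ : ℝ) + t * I : ℂ).re = 1 / 2 + δ := fun t => by simp
  have him : ∀ t : ℝ, ((1 / 2 + δ : ℝ) + t * I : ℂ).im = t := fun t => by simp
  have hIi : Integrable fun t : ℝ => F ((1 / 2 + δ : ℝ) + t * I) * K ((1 / 2 + δ : ℝ) + t * I) :=
    integrable_vertical (g := fun s => F s * K s) (D := D)
      (fun t => hId _ (hre t).ge (by rw [hre t]; exact hle))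
      (fun t => by
        have := hIb _ (hre t).ge (by rw [hre t]; exact hle)
        rwa [him] at this)
  have hJi : Integrable fun t : ℝ => F ((1 / 2 + δ : ℝ) + t * I) *
      K (1 + 2 * δ - ((1 / 2 + δ : ℝ) + t * I)) :=
    integrable_vertical (g := fun s => F s * K (1 + 2 * δ - s)) (D := D)
      (fun t => hJd _ (hre t).ge (by rw [hre t]; exact hle))
      (fun t => by
        have := hJb _ (hre t).ge (by rw [hre t]; exact hle)
        rwa [him] at this)
  have hconj : ∀ t : ℝ, K (1 + 2 * δ - ((1 / 2 + δ : ℝ) + t * I))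
      = conj (K ((1 / 2 + δ : ℝ) + t * I)) := by
    intro t
    rw [hK, ← trapezoidKernel_conj hx0 hh]
    congr 1
    rw [map_add, map_mul, conj_ofReal, conj_ofReal, conj_I]
    push_cast
    ring
  have hrefl : ∀ t : ℝ, K (1 + 2 * δ - ((1 + δ : ℝ) + t * I)) = K (δ - t * I) := by
    intro t
    congr 1
    push_cast
    ring
  simp_rw [hconj] at hJi hJ
  simp_rw [hrefl] at hJ
  refine ⟨?_, ?_⟩
  · have hm : Continuous fun t : ℝ => |(F ((1 / 2 + δ : ℝ) + t * I)).re| *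
        ‖K ((1 / 2 + δ : ℝ) + t * I)‖ := by
      refine (continuous_re.comp (continuous_vertical fun t => hFd _ (hre t).ge)).abs.mul
        (continuous_vertical fun t => differentiableAt_trapezoidKernel hx0 hh ?_).norm
      rw [hre t]
      linarith
    refine hIi.norm.mono' hm.aestronglyMeasurable (Eventually.of_forall fun t => ?_)
    rw [Real.norm_of_nonneg (by positivity), norm_mul]
    gcongr
    exact abs_re_le_norm _
  · rw [← hI, ← hJ]
    exact norm_integral_mul_le hIi hJi

/-- The reflected integral is small. -/
theorem exists_norm_integral_reflected_le (hGRH : GRH) : ∃ C : ℝ, 0 < C ∧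
    ∀ (q : ℕ) [NeZero q] (χ : DirichletCharacter ℂ q) (x h δ : ℝ), 1 ≤ x → 0 < h → 0 < δ →
      δ ≤ 1 / 2 →
      ‖∫ t : ℝ, logDeriv (regularL χ) ((1 + δ : ℝ) + t * I) * trapezoidKernel x h (δ - t * I)‖
        ≤ C * ((x + h) ^ (1 + δ) / (h * δ)) * (Real.log q + 4) := by
  obtain ⟨C, hC, hlog⟩ := exists_norm_logDeriv_regularL_le hGRH
  set W : ℝ := ∫ t : ℝ, (1 + t ^ 2) ^ (-(3 / 4) : ℝ) with hW
  have hW0 : 0 ≤ W := integral_nonneg fun t => by positivity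
  refine ⟨8 * C * (W + 1), by positivity, ?_⟩
  intro q _ χ x h δ hx hh hδ hδ1
  have hxh : 0 < x + h := by linarith
  have hq : (1 : ℝ) ≤ q := by exact_mod_cast NeZero.one_le
  have hlq : 0 ≤ Real.log q := Real.log_nonneg hq
  set M : ℝ := 8 * C * ((x + h) ^ (1 + δ) / (h * δ)) * (Real.log q + 4) with hM
  have hM0 : 0 ≤ M := by positivity
  have hbd : ∀ t : ℝ, ‖logDeriv (regularL χ) ((1 + δ : ℝ) + t * I) *
      trapezoidKernel x h (δ - t * I)‖ ≤ M * (1 + t ^ 2) ^ (-(3 / 4) : ℝ) := by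
    intro t
    have h1 := hlog q χ (1 / 2) ((1 + δ : ℝ) + t * I) (by norm_num) (by norm_num)
      (by simp; linarith) (by simp; linarith)
    have h2 := norm_trapezoidKernel_le_of_le_re (x := x) (h := h) (s := δ - t * I) (by linarith)
      hh hδ (by linarith) (by simp)
    have him : ((1 + δ : ℝ) + t * I : ℂ).im = t := by simp
    have hre' : (δ - t * I : ℂ).re + 1 = 1 + δ := by simp [add_comm]
    have him' : (δ - t * I : ℂ).im ^ 2 = t ^ 2 := by simp
    rw [him] at h1
    rw [hre', him'] at h2
    have h3 : Real.log (q * (|t| + 2)) ≤ (Real.log q + 4) * (1 + t ^ 2) ^ (1 / 4 : ℝ) := by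
      rw [Real.log_mul (by positivity) (by positivity)]
      have h4 := log_mul_abs_add_two_le (q := 1) zero_le_one t
      rw [one_mul, mul_one] at h4
      have h5 : (3 : ℝ) ^ (1 / 2 : ℝ) ≤ 2 := by
        rw [← Real.sqrt_eq_rpow, Real.sqrt_le_left (by norm_num)]; norm_num
      have h6 : 1 ≤ (1 + t ^ 2) ^ (1 / 4 : ℝ) := Real.one_le_rpow (by nlinarith) (by norm_num)
      nlinarith
    have h7 : (1 + t ^ 2) ^ (-(3 / 4) : ℝ) = (1 + t ^ 2) ^ (1 / 4 : ℝ) * (1 / (1 + t ^ 2)) := by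
      rw [one_div (1 + t ^ 2), ← Real.rpow_neg_one, ← Real.rpow_add (by positivity)]
      norm_num
    rw [norm_mul, h7]
    calc _ ≤ (C / (1 / 2) * ((Real.log q + 4) * (1 + t ^ 2) ^ (1 / 4 : ℝ))) *
          (4 * (x + h) ^ (1 + δ) / (h * δ) * (1 / (1 + t ^ 2))) := by
          refine mul_le_mul (h1.trans (by gcongr)) h2 (norm_nonneg _) (by positivity)
      _ = _ := by rw [hM]; ring
  refine (norm_integral_le_of_norm_le (integrable_one_add_sq_rpow.const_mul M)
    (Eventually.of_forall hbd)).trans ?_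
  rw [integral_const_mul, ← hW]
  calc M * W ≤ M * (W + 1) := by gcongr; linarith
    _ = _ := by rw [hM]; ring

lemma sum_range_one_add_rpow_le {η : ℝ} (hη : 0 < η) (N : ℕ) :
    ∑ n ∈ Finset.range N, (1 + n : ℝ) ^ (-1 - η) ≤ 1 + 1 / η := by
  rcases N with _ | N
  · simp; positivity
  rw [Finset.sum_range_succ']
  have hanti : AntitoneOn (fun t : ℝ => t ^ (-1 - η)) (Icc 1 (1 + N)) := by
    intro s hs t ht hst
    exact Real.rpow_le_rpow_of_nonpos (by linarith [hs.1]) hst (by linarith)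
  have h1 := hanti.sum_le_integral
  rw [integral_rpow (Or.inr ⟨by linarith, by
    rw [uIcc_of_le (by simp)]
    intro h
    linarith [h.1]⟩)] at h1
  have h2 : ((1 + N : ℝ) ^ (-1 - η + 1) - 1 ^ (-1 - η + 1)) / (-1 - η + 1) ≤ 1 / η := by
    have h3 : -1 - η + 1 = -η := by ring
    rw [h3, Real.one_rpow, div_neg, ← neg_div]
    gcongr
    have : 0 ≤ (1 + N : ℝ) ^ (-η) := by positivity
    linarith
  have h4 : (1 + ((0 : ℕ) : ℝ)) ^ (-1 - η) = 1 := by simp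
  rw [h4]
  linarith [h1.trans h2]

/-- An integral against a decaying weight of a function which is bounded on average. -/
lemma integral_mul_le_of_average_le {g k : ℝ → ℝ} {A C Q η : ℝ} (hg : Continuous g)
    (hk : Continuous k) (hg0 : ∀ t, 0 ≤ g t) (hi : Integrable fun t => g t * k t)
    (hA : 0 ≤ A) (hC : 0 ≤ C) (hQ : 1 ≤ Q) (hη : 0 < η)
    (hkA : ∀ t, k t ≤ A * (1 + |t|) ^ (-1 - η))
    (hgC : ∀ T, ∫ t in (T - 1 / 2)..(T + 1 / 2), g t ≤ C * Real.log (Q * (|T| + 2))) :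
    ∫ t, g t * k t ≤ 2 * A * C * (Real.log Q + 1 + 2 / η) * (1 + 2 / η) := by
  have hlQ : 0 ≤ Real.log Q := Real.log_nonneg hQ
  have hintg : ∀ a b : ℝ, IntervalIntegrable (fun t => g t * k t) volume a b := fun a b =>
    (hg.mul hk).intervalIntegrable a b
  have hunit : ∀ (n : ℕ) (T : ℝ), |T| = n + 1 / 2 →
      ∫ t in (T - 1 / 2)..(T + 1 / 2), g t * k t
        ≤ A * C * (Real.log Q + 1 + 2 / η) * (1 + n) ^ (-1 - η / 2) := by
    intro n T hT
    have hn : (0 : ℝ) ≤ n := Nat.cast_nonneg n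
    have h1 : ∫ t in (T - 1 / 2)..(T + 1 / 2), g t * k t
        ≤ ∫ t in (T - 1 / 2)..(T + 1 / 2), g t * (A * (1 + n) ^ (-1 - η)) := by
      refine intervalIntegral.integral_mono_on (by linarith) (hintg _ _)
        ((hg.mul continuous_const).intervalIntegrable _ _) fun t ht => ?_
      refine mul_le_mul_of_nonneg_left ((hkA t).trans ?_) (hg0 t)
      refine mul_le_mul_of_nonneg_left ?_ hA
      refine Real.rpow_le_rpow_of_nonpos (by positivity) ?_ (by linarith)
      have h2 : |T| - |t| ≤ |T - t| := abs_sub_abs_le_abs_sub T t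
      have h3 : |T - t| ≤ 1 / 2 := by rw [abs_le]; constructor <;> linarith [ht.1, ht.2]
      linarith
    rw [intervalIntegral.integral_mul_const] at h1
    have h4 : Real.log (Q * (|T| + 2)) ≤ (Real.log Q + 1 + 2 / η) * (1 + n) ^ (η / 2) := by
      rw [Real.log_mul (by positivity) (by positivity), hT]
      have h5 : Real.log (n + 1 / 2 + 2) ≤ 1 + Real.log (1 + n) := by
        have he : Real.log (Real.exp 1 * (1 + n)) = 1 + Real.log (1 + n) := by
          rw [Real.log_mul (Real.exp_pos 1).ne' (by positivity), Real.log_exp]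
        rw [← he]
        refine Real.log_le_log (by positivity) ?_
        have := Real.exp_one_gt_d9
        nlinarith
      have h6 := Real.log_le_rpow_div (x := 1 + (n : ℝ)) (by positivity) (half_pos hη)
      have h7 : (1 : ℝ) ≤ (1 + n : ℝ) ^ (η / 2) := Real.one_le_rpow (by linarith) (by positivity)
      have h8 : (1 + n : ℝ) ^ (η / 2) / (η / 2) = 2 / η * (1 + n : ℝ) ^ (η / 2) := by
        field_simp
      rw [h8] at h6
      nlinarith
    refine h1.trans ?_
    have h9 : (1 + n : ℝ) ^ (-1 - η / 2) = (1 + n : ℝ) ^ (η / 2) * (1 + n : ℝ) ^ (-1 - η) := by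
      rw [← Real.rpow_add (by positivity)]
      congr 1
      ring
    rw [h9]
    calc _ ≤ (C * ((Real.log Q + 1 + 2 / η) * (1 + n) ^ (η / 2))) * (A * (1 + n) ^ (-1 - η)) := by
          refine mul_le_mul_of_nonneg_right ((hgC T).trans ?_) (by positivity)
          gcongr
      _ = _ := by ring
  have hpartial : ∀ N : ℕ, ∫ t in (-(N : ℝ))..N, g t * k t
      ≤ 2 * (A * C * (Real.log Q + 1 + 2 / η)) *
        ∑ n ∈ Finset.range N, (1 + n : ℝ) ^ (-1 - η / 2) := by
    intro N
    induction N with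
    | zero => simp
    | succ N ih =>
      have h1 := hunit N (N + 1 / 2) (abs_of_nonneg (by positivity))
      have h2 := hunit N (-(N + 1 / 2)) (by rw [abs_neg]; exact abs_of_nonneg (by positivity))
      rw [Finset.sum_range_succ, mul_add]
      have e1 : (N + 1 / 2 - 1 / 2 : ℝ) = N := by ring
      have e2 : (N + 1 / 2 + 1 / 2 : ℝ) = (N + 1 : ℕ) := by push_cast; ring
      have e3 : (-(N + 1 / 2) - 1 / 2 : ℝ) = -((N + 1 : ℕ) : ℝ) := by push_cast; ring
      have e4 : (-(N + 1 / 2) + 1 / 2 : ℝ) = -(N : ℝ) := by ring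
      rw [e1, e2] at h1
      rw [e3, e4] at h2
      rw [← intervalIntegral.integral_add_adjacent_intervals (hintg (-((N + 1 : ℕ) : ℝ)) (-(N : ℝ)))
        (hintg _ _), ← intervalIntegral.integral_add_adjacent_intervals (hintg (-(N : ℝ)) N)
        (hintg _ _)]
      linarith
  have hlim := intervalIntegral_tendsto_integral hi
    (tendsto_neg_atTop_atBot.comp (tendsto_natCast_atTop_atTop (R := ℝ)))
    (tendsto_natCast_atTop_atTop (R := ℝ))
  refine le_of_tendsto' hlim fun N => (hpartial N).trans ?_
  have h1 := sum_range_one_add_rpow_le (half_pos hη) N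
  have h2 : 1 / (η / 2) = 2 / η := by field_simp
  rw [h2] at h1
  calc _ ≤ 2 * (A * C * (Real.log Q + 1 + 2 / η)) * (1 + 2 / η) := by gcongr
    _ = _ := by ring

end

section
open Complex MeasureTheory Set Filter Topology ArithmeticFunction

lemma neg_logDeriv_regularL {q : ℕ} [NeZero q] (χ : DirichletCharacter ℂ q) {s : ℂ}
    (hs : 1 < s.re) :
    -logDeriv (regularL χ) s = LSeries (fun n : ℕ => χ n * (vonMangoldt n : ℂ)) s
      - if χ = 1 then 1 / (s - 1) else 0 := by
  have hs1 : s ≠ 1 := by rintro rfl; simp at hs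
  have hL0 : DirichletCharacter.LFunction χ s ≠ 0 :=
    DirichletCharacter.LFunction_ne_zero_of_one_le_re χ (Or.inr hs1) hs.le
  have hLd : DifferentiableAt ℂ (DirichletCharacter.LFunction χ) s :=
    DirichletCharacter.differentiableAt_LFunction χ s (Or.inl hs1)
  have hLS : LSeries (fun n : ℕ => χ n * (vonMangoldt n : ℂ)) s
      = -logDeriv (DirichletCharacter.LFunction χ) s := by
    have := DirichletCharacter.LSeries_twist_vonMangoldt_eq χ hs
    rw [← DirichletCharacter.deriv_LFunction_eq_deriv_LSeries χ hs,
      ← DirichletCharacter.LFunction_eq_LSeries χ hs, neg_div] at this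
    exact this
  have hev : regularL χ =ᶠ[𝓝 s]
      fun z => (if χ = 1 then z - 1 else 1) * DirichletCharacter.LFunction χ z := by
    filter_upwards [isOpen_ne.mem_nhds hs1] with z hz
    exact regularL_of_ne_one χ hz
  have hld : logDeriv (regularL χ) s
      = logDeriv (fun z => (if χ = 1 then z - 1 else 1) * DirichletCharacter.LFunction χ z) s := by
    rw [logDeriv_apply, logDeriv_apply, hev.deriv_eq, hev.self_of_nhds]
  rw [hld, hLS]
  by_cases h : χ = 1
  · have heq : (fun z => (if χ = 1 then z - 1 else 1) * DirichletCharacter.LFunction χ z)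
        = fun z => (z - 1) * DirichletCharacter.LFunction χ z := by
      funext z
      rw [if_pos h]
    rw [heq, if_pos h, logDeriv_mul (f := fun z : ℂ => z - 1)
      (g := DirichletCharacter.LFunction χ) s (sub_ne_zero.mpr hs1) hL0 (by fun_prop) hLd,
      logDeriv_apply (fun z : ℂ => z - 1), deriv_sub_const, deriv_id'']
    ring
  · have heq : (fun z => (if χ = 1 then z - 1 else 1) * DirichletCharacter.LFunction χ z)
        = DirichletCharacter.LFunction χ := by
      funext z
      rw [if_neg h, one_mul]
    rw [heq, if_neg h, sub_zero]

lemma integral_LSeries_mul_rieszKernel {f : ℕ → ℂ} {c y : ℝ} (hc : 0 < c) (hy : 0 < y)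
    (hf : LSeriesSummable f c) :
    (Integrable fun t : ℝ => LSeries f (c + t * I) * rieszKernel y (c + t * I)) ∧
    ∫ t : ℝ, LSeries f (c + t * I) * rieszKernel y (c + t * I)
      = 2 * Real.pi * ∑ n ∈ Finset.Ico 1 ⌈y⌉₊, f n * (max (y - n) 0 : ℝ) := by
  have hre : ∀ t : ℝ, (c + t * I : ℂ).re = (c : ℂ).re := fun t => by simp
  have hnorm : ∀ (n : ℕ) (t : ℝ), ‖LSeries.term f (c + t * I) n‖ = ‖LSeries.term f c n‖ := by
    intro n t
    rw [LSeries.norm_term_eq, LSeries.norm_term_eq, hre]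
  have hk := integrable_rieszKernel hy hc
  have hterm : ∀ (n : ℕ) (t : ℝ), n ≠ 0 → LSeries.term f (c + t * I) n
      = f n * (((n : ℝ) : ℂ) ^ (-(c + t * I : ℂ))) := by
    intro n t hn
    rw [LSeries.term_of_ne_zero hn, cpow_neg, div_eq_mul_inv, ofReal_natCast]
  have hcont : ∀ n : ℕ, Continuous fun t : ℝ => LSeries.term f (c + t * I) n := by
    intro n
    rcases eq_or_ne n 0 with rfl | hn
    · simpa using continuous_const
    · simp_rw [hterm n _ hn]
      refine continuous_const.mul (Continuous.const_cpow (by fun_prop) (Or.inl ?_))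
      exact_mod_cast hn
  have hintg : ∀ n : ℕ, Integrable fun t : ℝ =>
      LSeries.term f (c + t * I) n * rieszKernel y (c + t * I) := by
    intro n
    refine hk.bdd_mul (hcont n).aestronglyMeasurable (c := ‖LSeries.term f c n‖)
      (Eventually.of_forall fun t => (hnorm n t).le)
  have hnint : ∀ n : ℕ, ∫ t : ℝ, ‖LSeries.term f (c + t * I) n * rieszKernel y (c + t * I)‖
      = ‖LSeries.term f c n‖ * ∫ t : ℝ, ‖rieszKernel y (c + t * I)‖ := by
    intro n
    simp_rw [norm_mul, hnorm]
    rw [integral_const_mul]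
  have hsum : Summable fun n : ℕ =>
      ∫ t : ℝ, ‖LSeries.term f (c + t * I) n * rieszKernel y (c + t * I)‖ := by
    simp_rw [hnint]
    exact (hf.norm).mul_right _
  have hLS : ∀ t : ℝ, ∑' n, LSeries.term f (c + t * I) n * rieszKernel y (c + t * I)
      = LSeries f (c + t * I) * rieszKernel y (c + t * I) := fun t => tsum_mul_right
  have hmain := hasSum_integral_of_summable_integral_norm hintg hsum
  simp_rw [hLS] at hmain
  have hval : ∀ n : ℕ, ∫ t : ℝ, LSeries.term f (c + t * I) n * rieszKernel y (c + t * I)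
      = if n = 0 then 0 else 2 * Real.pi * (f n * (max (y - n) 0 : ℝ)) := by
    intro n
    rcases eq_or_ne n 0 with rfl | hn
    · simp
    · rw [if_neg hn]
      simp_rw [hterm n _ hn, mul_assoc]
      rw [integral_const_mul, integral_cpow_mul_rieszKernel hc hy (by positivity)]
      ring
  simp_rw [hval] at hmain
  refine ⟨?_, ?_⟩
  · have hb : Integrable fun t : ℝ => (∑' n, ‖LSeries.term f c n‖) * ‖rieszKernel y (c + t * I)‖ :=
      hk.norm.const_mul _
    have hsumm : ∀ t : ℝ, Summable fun n => LSeries.term f (c + t * I) n := fun t =>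
      (LSeriesSummable_iff_of_re_eq_re (f := f) (hre t)).mpr hf
    have hmeas : Continuous fun t : ℝ => LSeries f (c + t * I) :=
      continuous_tsum hcont hf.norm fun n t => (hnorm n t).le
    refine hb.mono' ?_ (Eventually.of_forall fun t => ?_)
    · exact hmeas.aestronglyMeasurable.mul hk.aestronglyMeasurable
    · rw [norm_mul]
      gcongr
      rw [LSeries, ← tsum_congr fun n => hnorm n t]
      exact norm_tsum_le_tsum_norm (hsumm t).norm
  · refine hmain.unique ?_
    rw [Finset.mul_sum]
    have h1 : ∑ n ∈ Finset.Ico 1 ⌈y⌉₊, 2 * Real.pi * (f n * ((max (y - n) 0 : ℝ) : ℂ))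
        = ∑ n ∈ Finset.Ico 1 ⌈y⌉₊,
          if n = 0 then 0 else 2 * Real.pi * (f n * ((max (y - n) 0 : ℝ) : ℂ)) := by
      refine Finset.sum_congr rfl fun n hn => ?_
      rw [if_neg (by have := (Finset.mem_Ico.mp hn).1; omega)]
    rw [h1]
    refine hasSum_sum_of_ne_finset_zero fun n hn => ?_
    split_ifs with h0
    · rfl
    · have h2 : ⌈y⌉₊ ≤ n := by
        by_contra hcon
        exact hn (Finset.mem_Ico.mpr ⟨Nat.one_le_iff_ne_zero.mpr h0, not_le.mp hcon⟩)
      have h3 : y ≤ n := (Nat.le_ceil y).trans (by exact_mod_cast h2)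
      rw [max_eq_right (by linarith)]
      simp

/-- The weight which is `1` on `(-∞, x]`, vanishes on `[x + h, ∞)` and is linear in between. -/
noncomputable def trapezoid (x h u : ℝ) : ℝ := (max (x + h - u) 0 - max (x - u) 0) / h

lemma sum_Ico_ceil_extend (f : ℕ → ℂ) {x y : ℝ} (hxy : x ≤ y) :
    ∑ n ∈ Finset.Ico 1 ⌈x⌉₊, f n * (max (x - n) 0 : ℝ)
      = ∑ n ∈ Finset.Ico 1 ⌈y⌉₊, f n * (max (x - n) 0 : ℝ) := by
  refine Finset.sum_subset (Finset.Ico_subset_Ico_right (Nat.ceil_mono hxy)) fun n h1 h2 => ?_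
  have h3 : ⌈x⌉₊ ≤ n := by
    by_contra hcon
    exact h2 (Finset.mem_Ico.mpr ⟨(Finset.mem_Ico.mp h1).1, not_le.mp hcon⟩)
  have h4 : x ≤ n := (Nat.le_ceil x).trans (by exact_mod_cast h3)
  rw [max_eq_right (by linarith)]
  simp

/-- Perron's formula for the trapezoid weight. -/
lemma integral_logDeriv_mul_trapezoidKernel {q : ℕ} [NeZero q] (χ : DirichletCharacter ℂ q)
    {x h c : ℝ} (hx : 1 ≤ x) (hh : 0 < h) (hc : 1 < c) :
    ∫ t : ℝ, logDeriv (regularL χ) (c + t * I) * trapezoidKernel x h (c + t * I)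
      = -(2 * Real.pi * (∑ n ∈ Finset.Ico 1 ⌈x + h⌉₊,
          χ n * (vonMangoldt n : ℂ) * (trapezoid x h n : ℝ)
        - if χ = 1 then ((x - 1 + h / 2 : ℝ) : ℂ) else 0)) := by
  set f : ℕ → ℂ := fun n => χ n * (vonMangoldt n : ℂ) with hf
  have hfs : LSeriesSummable f c :=
    DirichletCharacter.LSeriesSummable_twist_vonMangoldt χ (by simpa using hc)
  have hc0 : 0 < c := by linarith
  have hriesz : ∀ y : ℝ, 1 ≤ y →
      (Integrable fun t : ℝ => logDeriv (regularL χ) (c + t * I) * rieszKernel y (c + t * I)) ∧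
      ∫ t : ℝ, logDeriv (regularL χ) (c + t * I) * rieszKernel y (c + t * I)
        = -(2 * Real.pi * (∑ n ∈ Finset.Ico 1 ⌈y⌉₊, f n * (max (y - n) 0 : ℝ)
          - if χ = 1 then (((y - 1) ^ 2 / 2 : ℝ) : ℂ) else 0)) := by
    intro y hy
    have hy0 : 0 < y := by linarith
    obtain ⟨h1, h2⟩ := integral_LSeries_mul_rieszKernel hc0 hy0 hfs
    have hpole : Integrable fun t : ℝ => rieszKernel y (c + t * I) / (c + t * I - 1) := by
      have hne : ∀ t : ℝ, (c + t * I - 1 : ℂ) ≠ 0 := by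
        intro t h
        have := congrArg re h
        simp at this
        linarith
      refine ((integrable_rieszKernel hy0 hc0).norm.const_mul (1 / (c - 1))).mono' ?_ ?_
      · refine Continuous.aestronglyMeasurable (Continuous.div₀ (continuous_vertical fun t =>
          differentiableAt_rieszKernel hy0 (by simpa using hc0)) (by fun_prop) hne)
      · filter_upwards with t
        rw [norm_div, div_eq_mul_one_div, mul_comm]
        have : c - 1 ≤ ‖(c + t * I - 1 : ℂ)‖ := by simpa using re_le_norm (c + t * I - 1 : ℂ)
        have hc1 : 0 < c - 1 := by linarith
        gcongr
    have hld : ∀ t : ℝ, logDeriv (regularL χ) (c + t * I) =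
        (if χ = 1 then 1 / (c + t * I - 1 : ℂ) else 0) - LSeries f (c + t * I) := by
      intro t
      have := neg_logDeriv_regularL χ (s := c + t * I) (by simpa using hc)
      rw [← neg_neg (logDeriv _ _), this, neg_sub]
    by_cases hχ : χ = 1
    · have heq : ∀ t : ℝ, logDeriv (regularL χ) (c + t * I) * rieszKernel y (c + t * I) =
          rieszKernel y (c + t * I) / (c + t * I - 1)
            - LSeries f (c + t * I) * rieszKernel y (c + t * I) := by
        intro t
        rw [hld, if_pos hχ]
        ring
      simp_rw [heq]
      refine ⟨hpole.sub h1, ?_⟩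
      rw [integral_sub hpole h1, h2, integral_rieszKernel_div hc hy, if_pos hχ]
      push_cast
      ring
    · have heq : ∀ t : ℝ, logDeriv (regularL χ) (c + t * I) * rieszKernel y (c + t * I) =
          -(LSeries f (c + t * I) * rieszKernel y (c + t * I)) := by
        intro t
        rw [hld, if_neg hχ]
        ring
      simp_rw [heq]
      refine ⟨h1.neg, ?_⟩
      rw [integral_neg, h2, if_neg hχ, sub_zero]
  obtain ⟨i1, e1⟩ := hriesz (x + h) (by linarith)
  obtain ⟨i2, e2⟩ := hriesz x hx
  have heq : ∀ t : ℝ, logDeriv (regularL χ) (c + t * I) * trapezoidKernel x h (c + t * I) =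
      (logDeriv (regularL χ) (c + t * I) * rieszKernel (x + h) (c + t * I)
        - logDeriv (regularL χ) (c + t * I) * rieszKernel x (c + t * I)) / h := by
    intro t
    rw [trapezoidKernel]
    ring
  simp_rw [heq]
  rw [integral_div, integral_sub i1 i2, e1, e2,
    sum_Ico_ceil_extend f (by linarith : x ≤ x + h)]
  have hh0 : (h : ℂ) ≠ 0 := by exact_mod_cast hh.ne'
  have hsum : ∑ n ∈ Finset.Ico 1 ⌈x + h⌉₊, f n * (trapezoid x h n : ℝ)
      = (∑ n ∈ Finset.Ico 1 ⌈x + h⌉₊, f n * (max (x + h - n) 0 : ℝ)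
        - ∑ n ∈ Finset.Ico 1 ⌈x + h⌉₊, f n * (max (x - n) 0 : ℝ)) / h := by
    rw [← Finset.sum_sub_distrib, Finset.sum_div]
    refine Finset.sum_congr rfl fun n _ => ?_
    rw [trapezoid]
    push_cast
    ring
  rw [hsum]
  split_ifs
  · push_cast
    field_simp
    ring
  · field_simp
    ring

end

section
open Complex MeasureTheory Set Filter Topology ArithmeticFunction

lemma norm_trapezoidKernel_le_div_norm {x h : ℝ} {s : ℂ} (hx : 0 < x) (hh : 0 < h)
    (hs : 0 < s.re) : ‖trapezoidKernel x h s‖ ≤ (x + h) ^ s.re / ‖s‖ := by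
  have hs0 : s ≠ 0 := by rintro rfl; simp at hs
  have hs1 : s ≠ -1 := by
    rintro rfl
    norm_num at hs
  have hs1' : s + 1 ≠ 0 := fun h => hs1 (eq_neg_of_add_eq_zero_left h)
  have hmvt := norm_image_sub_le_of_norm_deriv_le_segment'
    (f := fun y : ℝ => (y : ℂ) ^ (s + 1) / (s + 1)) (f' := fun y : ℝ => (y : ℂ) ^ s)
    (a := x) (b := x + h) (C := (x + h) ^ s.re)
    (fun y hy => (hasDerivAt_ofReal_cpow_const' (by linarith [hy.1]) hs1).hasDerivWithinAt)
    (fun y hy => by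
      have hy0 : 0 < y := by linarith [hy.1]
      rw [norm_cpow_eq_rpow_re_of_pos hy0]
      exact Real.rpow_le_rpow hy0.le hy.2.le hs.le)
    (x + h) ⟨by linarith, le_rfl⟩
  have heq : trapezoidKernel x h s = (((x + h : ℝ) : ℂ) ^ (s + 1) / (s + 1)
      - (x : ℂ) ^ (s + 1) / (s + 1)) / (s * h) := by
    have hh0 : (h : ℂ) ≠ 0 := by exact_mod_cast hh.ne'
    rw [trapezoidKernel, rieszKernel, rieszKernel]
    field_simp
  rw [heq, norm_div, norm_mul, norm_real, Real.norm_of_nonneg hh.le]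
  have hn : 0 < ‖s‖ := norm_pos_iff.mpr hs0
  rw [div_le_div_iff₀ (by positivity) hn]
  calc _ ≤ (x + h) ^ s.re * (x + h - x) * ‖s‖ := by gcongr
    _ = _ := by ring

lemma rpow_one_div_log {x : ℝ} (hx : 1 < x) : x ^ (1 / Real.log x) = Real.exp 1 := by
  rw [Real.rpow_def_of_pos (by linarith), mul_one_div_cancel (Real.log_pos hx).ne']

lemma norm_trapezoidKernel_sqrt_le {x : ℝ} (hx : Real.exp 2 ≤ x) (t : ℝ) :
    ‖trapezoidKernel x √x ((1 / 2 + 1 / Real.log x : ℝ) + t * I)‖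
      ≤ 48 * Real.exp 1 ^ 2 * √x * (1 + |t|) ^ (-1 - 1 / Real.log x) := by
  have hL : 2 ≤ Real.log x := (Real.le_log_iff_exp_le ((Real.exp_pos 2).trans_le hx)).mpr hx
  have hx1 : 1 < x := lt_of_lt_of_le (Real.one_lt_exp_iff.mpr two_pos) hx
  have hx0 : 0 < x := by linarith
  have hpow := rpow_one_div_log hx1
  set δ : ℝ := 1 / Real.log x with hδ
  have hδ0 : 0 < δ := by positivity
  have hδ1 : δ ≤ 1 / 2 := by rw [hδ]; gcongr
  set s : ℂ := (1 / 2 + δ : ℝ) + t * I with hs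
  have hre : s.re = 1 / 2 + δ := by simp [hs]
  have him : s.im = t := by simp [hs]
  have hsqrt : 0 < √x := Real.sqrt_pos.mpr hx0
  have hsq : √x * √x = x := Real.mul_self_sqrt hx0.le
  have hsx : √x ≤ x := by
    have : 1 ≤ √x := Real.one_le_sqrt.mpr hx1.le
    nlinarith
  have hn1 : (1 + |t|) / 3 ≤ ‖s‖ := by
    have h1 := (le_abs_self _).trans (abs_re_le_norm s)
    have h2 := abs_im_le_norm s
    rw [hre] at h1
    rw [him] at h2
    linarith
  have hn2 : (1 + |t|) / 2 ≤ ‖s + 1‖ := by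
    have h1 := (le_abs_self _).trans (abs_re_le_norm (s + 1))
    have h2 := abs_im_le_norm (s + 1)
    simp only [add_re, one_re, hre] at h1
    simp only [add_im, one_im, add_zero, him] at h2
    linarith
  have ht : 0 < 1 + |t| := by positivity
  have hs0 : 0 < ‖s‖ := lt_of_lt_of_le (by positivity) hn1
  have hs1 : 0 < ‖s + 1‖ := lt_of_lt_of_le (by positivity) hn2
  set R : ℝ := 2 * (x + √x) / (√x * ‖s + 1‖) with hR
  have hR0 : 0 < R := by positivity
  have b1 := norm_trapezoidKernel_le_div_norm hx0 hsqrt (s := s) (by rw [hre]; linarith)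
  have b2 := norm_trapezoidKernel_le hx0 hsqrt (s := s) (by rw [hre]; linarith)
  have b3 : 2 * (x + √x) ^ (s.re + 1) / √x * (1 / (‖s‖ * ‖s + 1‖))
      = (x + √x) ^ s.re / ‖s‖ * R := by
    rw [Real.rpow_add (by positivity), Real.rpow_one, hR]
    field_simp
  rw [b3] at b2
  have hB0 : 0 ≤ (x + √x) ^ s.re / ‖s‖ := by positivity
  have b4 : ‖trapezoidKernel x √x s‖ ≤ (x + √x) ^ s.re / ‖s‖ * R ^ δ := by
    rcases le_total R 1 with h | h
    · refine b2.trans (mul_le_mul_of_nonneg_left ?_ hB0)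
      simpa using Real.rpow_le_rpow_of_exponent_ge hR0 h (by linarith : δ ≤ 1)
    · refine b1.trans (le_mul_of_one_le_right hB0 (Real.one_le_rpow h hδ0.le))
  have hR1 : R ≤ 8 * x * (1 + |t|)⁻¹ := by
    have : R ≤ 2 * (x + x) / (1 * ((1 + |t|) / 2)) := by
      rw [hR]
      gcongr
      exact Real.one_le_sqrt.mpr hx1.le
    refine this.trans (le_of_eq ?_)
    field_simp
    ring
  have hR2 : R ^ δ ≤ 8 * Real.exp 1 * (1 + |t|) ^ (-δ) := by
    refine (Real.rpow_le_rpow hR0.le hR1 hδ0.le).trans ?_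
    rw [Real.mul_rpow (by positivity) (by positivity), Real.mul_rpow (by norm_num) hx0.le, hpow,
      Real.inv_rpow ht.le, Real.rpow_neg ht.le]
    gcongr
    simpa using Real.rpow_le_rpow_of_exponent_le (by norm_num : (1 : ℝ) ≤ 8)
      (by linarith : δ ≤ 1)
  have hP : (x + √x) ^ s.re ≤ 2 * (√x * Real.exp 1) := by
    have h1 : (x + √x) ^ s.re ≤ (2 * x) ^ s.re :=
      Real.rpow_le_rpow (by positivity) (by linarith) (by rw [hre]; linarith)
    refine h1.trans ?_
    rw [Real.mul_rpow (by norm_num) hx0.le, hre, Real.rpow_add hx0, hpow, ← Real.sqrt_eq_rpow]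
    gcongr
    simpa using Real.rpow_le_rpow_of_exponent_le (by norm_num : (1 : ℝ) ≤ 2)
      (by linarith : 1 / 2 + δ ≤ 1)
  calc _ ≤ (x + √x) ^ s.re / ‖s‖ * R ^ δ := b4
    _ ≤ 2 * (√x * Real.exp 1) / ((1 + |t|) / 3) * (8 * Real.exp 1 * (1 + |t|) ^ (-δ)) := by
        gcongr
    _ = _ := by
        rw [sub_eq_add_neg, Real.rpow_add ht, Real.rpow_neg_one]
        field_simp
        ring

/-- Under GRH, the smoothed Chebyshev sum of a Dirichlet character has a square-root size error
term, uniformly in the modulus. -/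
theorem exists_norm_sum_trapezoid_le (hGRH : GRH) : ∃ C : ℝ, 0 < C ∧
    ∀ (q : ℕ) [NeZero q] (χ : DirichletCharacter ℂ q) (x : ℝ), Real.exp 2 ≤ x →
      ‖∑ n ∈ Finset.Ico 1 ⌈x + √x⌉₊, χ n * (vonMangoldt n : ℂ) * (trapezoid x √x n : ℝ)
        - if χ = 1 then ((x - 1 + √x / 2 : ℝ) : ℂ) else 0‖
      ≤ C * √x * Real.log x * (Real.log q + Real.log x) := by
  obtain ⟨C₁, hC₁, h₁⟩ := exists_norm_integral_reflected_le hGRH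
  obtain ⟨C₂, hC₂, h₂⟩ := exists_integral_abs_re_logDeriv_regularL_le hGRH
  refine ⟨8 * Real.exp 1 * C₁ + 36 * (48 * Real.exp 1 ^ 2) * C₂, by positivity,
    fun q _ χ x hx => ?_⟩
  have hL : 2 ≤ Real.log x := (Real.le_log_iff_exp_le ((Real.exp_pos 2).trans_le hx)).mpr hx
  have hx1 : 1 < x := lt_of_lt_of_le (Real.one_lt_exp_iff.mpr two_pos) hx
  have hx0 : 0 < x := by linarith
  have hpow := rpow_one_div_log hx1
  have hker := norm_trapezoidKernel_sqrt_le hx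
  set δ : ℝ := 1 / Real.log x with hδ
  set L : ℝ := Real.log x with hLdef
  have hδ0 : 0 < δ := by positivity
  have hδ1 : δ ≤ 1 / 2 := by rw [hδ]; gcongr
  have hsqrt : 0 < √x := Real.sqrt_pos.mpr hx0
  have hsq : √x * √x = x := Real.mul_self_sqrt hx0.le
  have hsx : √x ≤ x := by
    have : 1 ≤ √x := Real.one_le_sqrt.mpr hx1.le
    nlinarith
  have hq : (1 : ℝ) ≤ q := by exact_mod_cast Nat.one_le_iff_ne_zero.mpr (NeZero.ne q)
  have hlq : 0 ≤ Real.log q := Real.log_nonneg hq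
  obtain ⟨hintg, hle⟩ := norm_integral_logDeriv_mul_trapezoidKernel_le hGRH χ hx1.le hsqrt hδ0 hδ1
  have hrefl := h₁ q χ x √x δ hx1.le hsqrt hδ0 hδ1
  have havg := integral_mul_le_of_average_le
    (g := fun t : ℝ => |(logDeriv (regularL χ) ((1 / 2 + δ : ℝ) + t * I)).re|)
    (k := fun t : ℝ => ‖trapezoidKernel x √x ((1 / 2 + δ : ℝ) + t * I)‖)
    (A := 48 * Real.exp 1 ^ 2 * √x) (C := C₂) (Q := q) (η := δ)
    (continuous_re.comp (continuous_logDeriv_regularL_vertical hGRH χ (by linarith))).abs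
    (continuous_vertical fun t => differentiableAt_trapezoidKernel hx0 hsqrt
      (by simp; linarith)).norm
    (fun t => abs_nonneg _) hintg (by positivity) hC₂.le hq hδ0 hker
    (fun T => h₂ q χ _ T (by linarith) (by linarith))
  have hperron := integral_logDeriv_mul_trapezoidKernel χ hx1.le hsqrt (c := 1 + δ) (by linarith)
  rw [hperron, norm_neg, norm_mul] at hle
  have hpi : 1 ≤ ‖(2 * Real.pi : ℂ)‖ := by
    rw [norm_mul, norm_real, Real.norm_of_nonneg Real.pi_pos.le]
    norm_num
    linarith [Real.pi_gt_three]
  have hlow := (le_mul_of_one_le_left (norm_nonneg _) hpi).trans hle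
  have h2δ : 2 / δ = 2 * L := by rw [hδ]; field_simp
  rw [h2δ] at havg
  have hP : (x + √x) ^ (1 + δ) / (√x * δ) ≤ 4 * Real.exp 1 * √x * L := by
    have h1 : (x + √x) ^ (1 + δ) ≤ (2 * x) ^ (1 + δ) :=
      Real.rpow_le_rpow (by positivity) (by linarith) (by linarith)
    have h2 : (2 : ℝ) ^ (1 + δ) ≤ 4 := by
      have := Real.rpow_le_rpow_of_exponent_le (by norm_num : (1 : ℝ) ≤ 2)
        (by linarith : 1 + δ ≤ 2)
      norm_num at this
      exact this
    have h3 : (2 * x) ^ (1 + δ) ≤ 4 * (x * Real.exp 1) := by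
      rw [Real.mul_rpow (by norm_num) hx0.le, Real.rpow_add hx0 1, hpow, Real.rpow_one]
      gcongr
    rw [div_le_iff₀ (by positivity)]
    refine (h1.trans h3).trans (le_of_eq ?_)
    have hLd : L * δ = 1 := by rw [hδ]; field_simp
    calc _ = 4 * Real.exp 1 * (√x * √x) * 1 := by rw [hsq]; ring
      _ = 4 * Real.exp 1 * (√x * √x) * (L * δ) := by rw [hLd]
      _ = _ := by ring
  calc _ ≤ _ := hlow
    _ ≤ C₁ * (4 * Real.exp 1 * √x * L) * (2 * (Real.log q + L))
        + 2 * (2 * (48 * Real.exp 1 ^ 2 * √x) * C₂ * (3 * (Real.log q + L)) * (3 * L)) := by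
        refine add_le_add (hrefl.trans ?_) (mul_le_mul_of_nonneg_left (havg.trans ?_) two_pos.le)
        · gcongr
          linarith
        · gcongr <;> linarith
    _ = _ := by ring

end

section
open ArithmeticFunction ArithmeticFunction.vonMangoldt

/-- Under GRH, the smoothed Chebyshev sum over a reduced residue class. -/
theorem exists_abs_sum_residueClass_mul_trapezoid_sub_le (hGRH : GRH) : ∃ C : ℝ, 0 < C ∧
    ∀ (q : ℕ) [NeZero q] (a : ZMod q) (x : ℝ), IsUnit a → Real.exp 2 ≤ x →
      |∑ n ∈ Finset.Ico 1 ⌈x + √x⌉₊, residueClass a n * trapezoid x √x n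
        - (x - 1 + √x / 2) / q.totient|
      ≤ C * √x * Real.log x * (Real.log q + Real.log x) := by
  obtain ⟨C, hC, h⟩ := exists_norm_sum_trapezoid_le hGRH
  refine ⟨C, hC, fun q _ a x ha hx => ?_⟩
  set M : ℝ := x - 1 + √x / 2 with hM
  set B : ℝ := C * √x * Real.log x * (Real.log q + Real.log x) with hB
  have hφ : (0 : ℝ) < q.totient := by exact_mod_cast Nat.totient_pos.mpr (NeZero.pos q)
  have hua : IsUnit a⁻¹ := by
    obtain ⟨u, rfl⟩ := ha
    rw [ZMod.inv_coe_unit]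
    exact Units.isUnit _
  have hmain : ∑ χ : DirichletCharacter ℂ q, χ a⁻¹ * (if χ = 1 then (M : ℂ) else 0) = M := by
    simp only [mul_ite, mul_zero]
    rw [Finset.sum_ite_eq' Finset.univ (1 : DirichletCharacter ℂ q) (fun χ => χ a⁻¹ * (M : ℂ)),
      if_pos (Finset.mem_univ _), MulChar.one_apply hua, one_mul]
  have hsum : ((∑ n ∈ Finset.Ico 1 ⌈x + √x⌉₊, residueClass a n * trapezoid x √x n : ℝ) : ℂ)
      = (q.totient : ℂ)⁻¹ * ∑ χ : DirichletCharacter ℂ q, χ a⁻¹ *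
        ∑ n ∈ Finset.Ico 1 ⌈x + √x⌉₊, χ n * (vonMangoldt n : ℂ) * (trapezoid x √x n : ℝ) := by
    push_cast
    simp_rw [Finset.mul_sum]
    rw [Finset.sum_comm]
    refine Finset.sum_congr rfl fun n _ => ?_
    rw [residueClass_apply ha, Finset.mul_sum, Finset.sum_mul]
    refine Finset.sum_congr rfl fun χ _ => ?_
    ring
  have hdiff : ((∑ n ∈ Finset.Ico 1 ⌈x + √x⌉₊, residueClass a n * trapezoid x √x n
        - M / q.totient : ℝ) : ℂ)
      = (q.totient : ℂ)⁻¹ * ∑ χ : DirichletCharacter ℂ q, χ a⁻¹ *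
        (∑ n ∈ Finset.Ico 1 ⌈x + √x⌉₊, χ n * (vonMangoldt n : ℂ) * (trapezoid x √x n : ℝ)
          - if χ = 1 then (M : ℂ) else 0) := by
    simp_rw [mul_sub]
    rw [Finset.sum_sub_distrib, hmain, Complex.ofReal_sub, hsum, mul_sub]
    push_cast
    ring
  rw [← Real.norm_eq_abs, ← Complex.norm_real, hdiff, norm_mul, norm_inv, Complex.norm_natCast,
    inv_mul_le_iff₀ hφ]
  refine (norm_sum_le _ _).trans ?_
  have hcard : (Finset.univ : Finset (DirichletCharacter ℂ q)).card = q.totient := by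
    rw [Finset.card_univ, ← Nat.card_eq_fintype_card]
    exact DirichletCharacter.card_eq_totient_of_hasEnoughRootsOfUnity ℂ q
  rw [← hcard, ← nsmul_eq_mul]
  refine Finset.sum_le_card_nsmul _ _ _ fun χ _ => ?_
  rw [norm_mul]
  exact (mul_le_of_le_one_left (norm_nonneg _) (χ.norm_le_one _)).trans (h q χ x hx)

lemma trapezoid_nonneg {x h : ℝ} (hh : 0 < h) (u : ℝ) : 0 ≤ trapezoid x h u :=
  div_nonneg (sub_nonneg.mpr (max_le_max (by linarith) le_rfl)) hh.le

lemma trapezoid_le_one {x h : ℝ} (hh : 0 < h) (u : ℝ) : trapezoid x h u ≤ 1 := by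
  rw [trapezoid, div_le_one hh, sub_le_iff_le_add]
  refine max_le ?_ ?_ <;> linarith [le_max_left (x - u) 0, le_max_right (x - u) 0]

lemma trapezoid_of_le {x h u : ℝ} (hh : 0 < h) (hu : u ≤ x) : trapezoid x h u = 1 := by
  rw [trapezoid, max_eq_left (by linarith), max_eq_left (by linarith), div_eq_one_iff_eq hh.ne']
  ring

lemma sum_residueClass_le {q : ℕ} (a : ZMod q) {x h : ℝ} (hh : 0 < h) :
    ∑ n ∈ Finset.Ico 1 ⌈x⌉₊, residueClass a n
      ≤ ∑ n ∈ Finset.Ico 1 ⌈x + h⌉₊, residueClass a n * trapezoid x h n := by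
  refine le_trans (le_of_eq ?_) (Finset.sum_le_sum_of_subset_of_nonneg
    (Finset.Ico_subset_Ico_right (Nat.ceil_mono (by linarith : x ≤ x + h)))
    fun n _ _ => mul_nonneg (residueClass_nonneg a n) (trapezoid_nonneg hh n))
  refine Finset.sum_congr rfl fun n hn => ?_
  rw [trapezoid_of_le hh (Nat.lt_ceil.mp (Finset.mem_Ico.mp hn).2).le, mul_one]

lemma le_sum_residueClass {q : ℕ} (a : ZMod q) {x y h : ℝ} (hh : 0 < h) (hy : y + h ≤ x) :
    ∑ n ∈ Finset.Ico 1 ⌈y + h⌉₊, residueClass a n * trapezoid y h n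
      ≤ ∑ n ∈ Finset.Ico 1 ⌈x⌉₊, residueClass a n := by
  refine le_trans (Finset.sum_le_sum fun n _ => mul_le_of_le_one_right (residueClass_nonneg a n)
    (trapezoid_le_one hh n)) (Finset.sum_le_sum_of_subset_of_nonneg
      (Finset.Ico_subset_Ico_right (Nat.ceil_mono hy)) fun n _ _ => residueClass_nonneg a n)

lemma theta_eq_sum_residueClass (x : ℝ) (q : ℕ) (a : ℤ) :
    theta x q a = ∑ n ∈ Finset.Ico 1 ⌈x⌉₊ with n.Prime, residueClass (a : ZMod q) n := by
  have hset : (Finset.range ⌈x⌉₊).filter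
      (fun p : ℕ => p.Prime ∧ (p : ZMod q) = (a : ZMod q))
      = ((Finset.Ico 1 ⌈x⌉₊).filter Nat.Prime).filter
        fun p : ℕ => (p : ZMod q) = (a : ZMod q) := by
    ext p
    simp only [Finset.mem_filter, Finset.mem_range, Finset.mem_Ico]
    constructor
    · rintro ⟨h1, h2, h3⟩
      exact ⟨⟨⟨h2.one_le, h1⟩, h2⟩, h3⟩
    · rintro ⟨⟨⟨-, h1⟩, h2⟩, h3⟩
      exact ⟨h1, h2, h3⟩
  rw [theta, hset, Finset.sum_filter]
  refine Finset.sum_congr rfl fun p hp => ?_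
  simp only [Set.indicator_apply, Set.mem_ofPred_eq,
    vonMangoldt_apply_prime (Finset.mem_filter.mp hp).2]

lemma sum_residueClass_sub_theta_mem {x : ℝ} (hx : 1 ≤ x) (q : ℕ) (a : ℤ) :
    theta x q a ≤ ∑ n ∈ Finset.Ico 1 ⌈x⌉₊, residueClass (a : ZMod q) n ∧
    ∑ n ∈ Finset.Ico 1 ⌈x⌉₊, residueClass (a : ZMod q) n
      ≤ theta x q a + 2 * √x * Real.log x := by
  rw [theta_eq_sum_residueClass, ← Finset.sum_filter_add_sum_filter_not (Finset.Ico 1 ⌈x⌉₊)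
    Nat.Prime (fun n => residueClass (a : ZMod q) n)]
  refine ⟨le_add_of_nonneg_right (Finset.sum_nonneg fun n _ => residueClass_nonneg _ n),
    add_le_add_right ?_ _⟩
  refine le_trans ?_ (Chebyshev.psi_sub_theta_le hx)
  rw [Chebyshev.psi_sub_theta_eq_sum_not_prime]
  refine (Finset.sum_le_sum fun n _ => residueClass_le _ n).trans ?_
  refine Finset.sum_le_sum_of_subset_of_nonneg (fun n hn => ?_) fun n _ _ => vonMangoldt_nonneg
  simp only [Finset.mem_filter, Finset.mem_Ico, Finset.mem_Ioc] at hn ⊢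
  exact ⟨⟨hn.1.1, Nat.le_floor (Nat.lt_ceil.mp hn.1.2).le⟩, hn.2⟩

/-- Under GRH, the prime number theorem in arithmetic progressions with square-root size error
term, uniformly in the modulus. -/
theorem exists_abs_theta_sub_le (hGRH : GRH) : ∃ C : ℝ, 0 < C ∧
    ∀ (q : ℕ) [NeZero q] (a : ℤ) (x : ℝ), IsUnit (a : ZMod q) → Real.exp 4 ≤ x →
      |theta x q a - x / q.totient| ≤ C * √x * Real.log x * (Real.log q + Real.log x) := by
  obtain ⟨C, hC, h⟩ := exists_abs_sum_residueClass_mul_trapezoid_sub_le hGRH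
  refine ⟨C + 4, by positivity, fun q _ a x ha hx => ?_⟩
  have he2 : (2 : ℝ) ≤ Real.exp 2 := by linarith [Real.add_one_le_exp (2 : ℝ)]
  have he4 : Real.exp 4 = Real.exp 2 * Real.exp 2 := by rw [← Real.exp_add]; norm_num
  have hx0 : 0 < x := (Real.exp_pos 4).trans_le hx
  have hL : 4 ≤ Real.log x := (Real.le_log_iff_exp_le hx0).mpr hx
  have hsq : √x * √x = x := Real.mul_self_sqrt hx0.le
  have hs2 : 2 ≤ √x := Real.le_sqrt_of_sq_le (by nlinarith)
  have hq : (1 : ℝ) ≤ q := by exact_mod_cast Nat.one_le_iff_ne_zero.mpr (NeZero.ne q)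
  have hlq : 0 ≤ Real.log q := Real.log_nonneg hq
  have hφ : (1 : ℝ) ≤ q.totient := by exact_mod_cast Nat.totient_pos.mpr (NeZero.pos q)
  set y : ℝ := x - √x with hy
  have hyx : x / 2 ≤ y := by nlinarith
  have hy2 : Real.exp 2 ≤ y := by nlinarith
  have hy0 : 0 < y := by linarith
  have hsy : √y ≤ √x := Real.sqrt_le_sqrt (by linarith)
  have hsy0 : 0 < √y := Real.sqrt_pos.mpr hy0
  have hly : Real.log y ≤ Real.log x := Real.log_le_log hy0 (by linarith)
  have hly0 : 0 ≤ Real.log y := Real.log_nonneg (by linarith)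
  have hx2 : Real.exp 2 ≤ x := by linarith
  have hup := (sum_residueClass_le (a : ZMod q) (x := x) (by linarith : 0 < √x))
  have hlo := (le_sum_residueClass (a : ZMod q) (x := x) (y := y) hsy0 (by linarith))
  obtain ⟨ht1, ht2⟩ := sum_residueClass_sub_theta_mem (by linarith : 1 ≤ x) q a
  have hux := (abs_le.mp (h q (a : ZMod q) x ha hx2)).2
  have hly' := (abs_le.mp (h q (a : ZMod q) y ha hy2)).1
  have hB : C * √y * Real.log y * (Real.log q + Real.log y)
      ≤ C * √x * Real.log x * (Real.log q + Real.log x) := by gcongr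
  have hm1 : (x - 1 + √x / 2) / q.totient ≤ x / q.totient + √x := by
    rw [div_add' _ _ _ (by linarith), div_le_div_iff_of_pos_right (by linarith)]
    nlinarith
  have hm2 : x / q.totient - 2 * √x ≤ (y - 1 + √y / 2) / q.totient := by
    rw [div_sub' (by linarith), div_le_div_iff_of_pos_right (by linarith)]
    nlinarith
  have hS : √x * Real.log x * 1 ≤ √x * Real.log x * (Real.log q + Real.log x) := by
    gcongr
    linarith
  have hS' : √x ≤ √x * Real.log x := by nlinarith
  rw [abs_le]
  constructor <;> nlinarith

lemma isUnit_cast_zmod_sq_mul_sq {m n : ℕ} {a : ℤ} (hm : Odd m) (hn : Odd n)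
    (h1 : a ≡ -2 [ZMOD ((m : ℤ) ^ 2)]) (h2 : a ≡ 2 [ZMOD ((n : ℤ) ^ 2)]) :
    IsUnit (a : ZMod (m ^ 2 * n ^ 2)) := by
  have hodd : ∀ {k : ℕ}, Odd k → IsCoprime ((k : ℤ) ^ 2) 2 := fun {k} hk =>
    (Nat.isCoprime_iff_coprime.mpr (Nat.coprime_two_right.mpr hk)).pow_left
  have hadd : ∀ {k b c : ℤ}, IsCoprime k b → c ≡ b [ZMOD k] → IsCoprime k c := by
    intro k b c hb hc
    obtain ⟨d, hd⟩ := hc.symm.dvd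
    rw [show c = b + k * d by linarith]
    exact hb.add_mul_left_right d
  rw [ZMod.coe_int_isUnit_iff_isCoprime]
  push_cast
  exact (hadd (hodd hm).neg_right h1).mul_left (hadd (hodd hn) h2)

end

/-- Under GRH, for `0 < ε < α` and residues `a(m,n) ≡ -2 (mod m²)`, `a(m,n) ≡ 2 (mod n²)`,
the sum of the errors `|θ(x; m²n², a(m,n)) - x/φ(m²n²)|` over odd coprime pairs `m, n`
strictly between `x^ε` and `x^α` is `O(x^(1/2 + 2α)·(log x)²)` as `x → ∞`. -/
theorem error_term_bound_GRH (hGRH : GRH) (ε α : ℝ) (hε : 0 < ε) (hεα : ε < α)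
    (a : ℕ → ℕ → ℤ)
    (ha : ∀ m n : ℕ, 0 < m → 0 < n → Odd m → Odd n → Nat.Coprime m n →
      a m n ≡ -2 [ZMOD ((m : ℤ) ^ 2)] ∧ a m n ≡ 2 [ZMOD ((n : ℤ) ^ 2)]) :
    Asymptotics.IsBigO Filter.atTop
      (fun x : ℝ =>
        ∑ m ∈ Finset.range ⌈x ^ α⌉₊, ∑ n ∈ Finset.range ⌈x ^ α⌉₊,
          if 0 < m ∧ 0 < n ∧ Odd m ∧ Odd n ∧ Nat.Coprime m n ∧
              x ^ ε < m ∧ (m : ℝ) < x ^ α ∧ x ^ ε < n ∧ (n : ℝ) < x ^ α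
            then |theta x (m ^ 2 * n ^ 2) (a m n) - x / (Nat.totient (m ^ 2 * n ^ 2) : ℝ)|
            else 0)
      (fun x : ℝ => x ^ ((1 : ℝ) / 2 + 2 * α) * Real.log x ^ 2) := by
  obtain ⟨C, hC, h⟩ := exists_abs_theta_sub_le hGRH
  have hα : 0 < α := hε.trans hεα
  refine Asymptotics.IsBigO.of_bound (4 * C * (4 * α + 1)) ?_
  filter_upwards [Filter.eventually_ge_atTop (Real.exp 4)] with x hx
  have hx0 : 0 < x := (Real.exp_pos 4).trans_le hx
  have hx1 : 1 ≤ x := (Real.one_le_exp (by norm_num)).trans hx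
  have hL : 0 ≤ Real.log x := Real.log_nonneg hx1
  have hxα : 1 ≤ x ^ α := Real.one_le_rpow hx1 hα.le
  set B : ℝ := C * √x * Real.log x * ((4 * α + 1) * Real.log x) with hB
  have hB0 : 0 ≤ B := by positivity
  have hterm : ∀ m n : ℕ,
      (if 0 < m ∧ 0 < n ∧ Odd m ∧ Odd n ∧ Nat.Coprime m n ∧
          x ^ ε < m ∧ (m : ℝ) < x ^ α ∧ x ^ ε < n ∧ (n : ℝ) < x ^ α
        then |theta x (m ^ 2 * n ^ 2) (a m n) - x / (Nat.totient (m ^ 2 * n ^ 2) : ℝ)|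
        else 0) ≤ B := by
    intro m n
    split_ifs with hmn
    · obtain ⟨hm, hn, hmo, hno, hco, -, hmx, -, hnx⟩ := hmn
      obtain ⟨h1, h2⟩ := ha m n hm hn hmo hno hco
      have : NeZero (m ^ 2 * n ^ 2) := ⟨by positivity⟩
      refine (h _ (a m n) x (isUnit_cast_zmod_sq_mul_sq hmo hno h1 h2) hx).trans ?_
      have hlog : ∀ {k : ℕ}, 0 < k → (k : ℝ) < x ^ α → Real.log k ≤ α * Real.log x := by
        intro k hk hkx
        rw [← Real.log_rpow hx0]
        exact Real.log_le_log (by exact_mod_cast hk) hkx.le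
      have hq : Real.log ((m ^ 2 * n ^ 2 : ℕ) : ℝ) ≤ 4 * α * Real.log x := by
        push_cast
        rw [Real.log_mul (by positivity) (by positivity), Real.log_pow, Real.log_pow]
        push_cast
        linarith [hlog hm hmx, hlog hn hnx]
      rw [hB]
      gcongr
      linarith
    · exact hB0
  have hnn : ∀ m n : ℕ, 0 ≤
      (if 0 < m ∧ 0 < n ∧ Odd m ∧ Odd n ∧ Nat.Coprime m n ∧
          x ^ ε < m ∧ (m : ℝ) < x ^ α ∧ x ^ ε < n ∧ (n : ℝ) < x ^ α
        then |theta x (m ^ 2 * n ^ 2) (a m n) - x / (Nat.totient (m ^ 2 * n ^ 2) : ℝ)|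
        else 0) := by
    intro m n
    split_ifs
    · exact abs_nonneg _
    · exact le_rfl
  rw [Real.norm_of_nonneg (Finset.sum_nonneg fun m _ => Finset.sum_nonneg fun n _ => hnn m n),
    Real.norm_of_nonneg (by positivity)]
  have hN : (⌈x ^ α⌉₊ : ℝ) ≤ 2 * x ^ α := by
    linarith [Nat.ceil_lt_add_one (zero_le_one.trans hxα)]
  calc _ ≤ ∑ m ∈ Finset.range ⌈x ^ α⌉₊, ∑ n ∈ Finset.range ⌈x ^ α⌉₊, B :=
        Finset.sum_le_sum fun m _ => Finset.sum_le_sum fun n _ => hterm m n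
    _ = ⌈x ^ α⌉₊ * (⌈x ^ α⌉₊ * B) := by simp
    _ ≤ 2 * x ^ α * (2 * x ^ α * B) := by gcongr
    _ = _ := by
        rw [hB, Real.rpow_add hx0, ← Real.sqrt_eq_rpow, two_mul α, Real.rpow_add hx0]
        ring
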